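/- In the rank-1 case, if E(log σ_0) > 0 then for every (α,i) ∈ {1,…,m}×ℤ, P^e_{αi}(lim_{n→∞} X_n = −∞) = 1 for a.e. e; if E(log σ_0) < 0 then for every (α,i), P^e_{αi}(lim_{n→∞} X_n = +∞) = 1 for a.e. e; and if E(log σ_0) = 0 then for every (α,i), P^e_{αi}(liminf_{n→∞} X_n = −∞ and limsup_{n→∞} X_n = +∞) = 1 for a.e. e. -/

import Mathlib

open MeasureTheory Filter Matrix
open scoped ENNReal Topology

namespace Parrondo

/-- One-step transition probability of the regime-switching random walk:
`P_{αi,βj} = Q_{αβ} P^{(β)}_{ij}` with `P^{(β)}_{i,i+1} = p^{(β)}_i`,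
`P^{(β)}_{i,i-1} = 1 - p^{(β)}_i`. -/
noncomputable def step {ι : Type*} (Q : Matrix ι ι ℝ) (p : ι → ℤ → ℝ) (s s' : ι × ℤ) : ℝ :=
  Q s.1 s'.1 *
    (if s'.2 = s.2 + 1 then p s'.1 s.2
     else if s'.2 = s.2 - 1 then 1 - p s'.1 s.2 else 0)

/-- `μ α i` is the quenched law of the regime-switching walk `(G_n, X_n)` started at `(α, i)`,
characterized by its values on cylinder sets. -/
def IsQuenchedLaw {ι : Type*} [DecidableEq ι] [MeasurableSpace ι]
    (Q : Matrix ι ι ℝ) (p : ι → ℤ → ℝ) (μ : ι → ℤ → Measure (ℕ → ι × ℤ)) : Prop :=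
  ∀ (α : ι) (i : ℤ),
    IsProbabilityMeasure (μ α i) ∧
    ∀ (n : ℕ) (traj : ℕ → ι × ℤ),
      μ α i {ω | ∀ k ≤ n, ω k = traj k} =
        (if traj 0 = (α, i) then 1 else 0) *
          ENNReal.ofReal (∏ k ∈ Finset.range n, step Q p (traj k) (traj (k + 1)))

/-- The event `{τ_ℓ < ∞}` where `τ_ℓ = inf {n ≥ 1 : X_n = ℓ}`. -/
def hitEvent {ι : Type*} (ℓ : ℤ) : Set (ℕ → ι × ℤ) := {ω | ∃ n : ℕ, 1 ≤ n ∧ (ω n).2 = ℓ}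

/-- The event `{τ_ℓ < ∞, G_{τ_ℓ} = β}`. -/
def hitRegimeEvent {ι : Type*} (ℓ : ℤ) (β : ι) : Set (ℕ → ι × ℤ) :=
  {ω | ∃ n : ℕ, 1 ≤ n ∧ (ω n).2 = ℓ ∧ (ω n).1 = β ∧ ∀ k, 1 ≤ k → k < n → (ω k).2 ≠ ℓ}

/-- The event `{X_n ≤ ℓ infinitely often}`. -/
def belowIO {ι : Type*} (ℓ : ℤ) : Set (ℕ → ι × ℤ) := {ω | ∃ᶠ n in atTop, (ω n).2 ≤ ℓ}

/-- The event `{lim_n X_n = +∞}`. -/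
def driftTop {ι : Type*} : Set (ℕ → ι × ℤ) := {ω | Tendsto (fun n => (ω n).2) atTop atTop}

/-- The event `{lim_n X_n = -∞}`. -/
def driftBot {ι : Type*} : Set (ℕ → ι × ℤ) := {ω | Tendsto (fun n => (ω n).2) atTop atBot}

/-- The event `{liminf_n X_n = -∞ and limsup_n X_n = +∞}`. -/
def oscillate {ι : Type*} : Set (ℕ → ι × ℤ) :=
  {ω | (∀ M : ℤ, ∃ᶠ n in atTop, (ω n).2 < M) ∧ ∀ M : ℤ, ∃ᶠ n in atTop, M < (ω n).2}

/-- `‖f_{iℓ}‖ = max_α P_{αi}(τ_ℓ < ∞)`. -/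
noncomputable def fnorm {ι : Type*} [Fintype ι] [MeasurableSpace ι]
    (μ : ι → ℤ → Measure (ℕ → ι × ℤ)) (i ℓ : ℤ) : ℝ :=
  ⨆ α : ι, (μ α i (hitEvent ℓ)).toReal

/-- One step of the chain `(G_n, X_n)` has positive probability (the probabilities `p` being
in `(0,1)`, this only depends on `Q`). -/
def StepPos {ι : Type*} (Q : Matrix ι ι ℝ) (s s' : ι × ℤ) : Prop :=
  0 < Q s.1 s'.1 ∧ (s'.2 = s.2 + 1 ∨ s'.2 = s.2 - 1)

/-- Irreducibility of the Markov chain `(G_n, X_n)`. -/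
def ChainIrreducible {ι : Type*} (Q : Matrix ι ι ℝ) : Prop :=
  ∀ s s' : ι × ℤ, ∃ (n : ℕ) (c : ℕ → ι × ℤ),
    c 0 = s ∧ c n = s' ∧ ∀ k < n, StepPos Q (c k) (c (k + 1))

/-- Irreducibility of the Markov chain `G_n` with transition matrix `Q`. -/
def MatIrreducible {ι : Type*} (Q : Matrix ι ι ℝ) : Prop :=
  ∀ α β : ι, ∃ (n : ℕ) (g : ℕ → ι), g 0 = α ∧ g n = β ∧ ∀ k < n, 0 < Q (g k) (g (k + 1))

/-- One-step transition probability of a nearest-neighbour random walk on `ℤ`. -/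
noncomputable def stepRW (p : ℤ → ℝ) (i j : ℤ) : ℝ :=
  if j = i + 1 then p i else if j = i - 1 then 1 - p i else 0

/-- `μ i` is the quenched law of the nearest-neighbour walk on `ℤ` started at `i`. -/
def IsRWLaw (p : ℤ → ℝ) (μ : ℤ → Measure (ℕ → ℤ)) : Prop :=
  ∀ i : ℤ,
    IsProbabilityMeasure (μ i) ∧
    ∀ (n : ℕ) (traj : ℕ → ℤ),
      μ i {ω | ∀ k ≤ n, ω k = traj k} =
        (if traj 0 = i then 1 else 0) *
          ENNReal.ofReal (∏ k ∈ Finset.range n, stepRW p (traj k) (traj (k + 1)))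

def driftTopZ : Set (ℕ → ℤ) := {ω | Tendsto ω atTop atTop}

def driftBotZ : Set (ℕ → ℤ) := {ω | Tendsto ω atTop atBot}

def oscillateZ : Set (ℕ → ℤ) :=
  {ω | (∀ M : ℤ, ∃ᶠ n in atTop, ω n < M) ∧ ∀ M : ℤ, ∃ᶠ n in atTop, M < ω n}

/-- A norm on matrices (all norms being equivalent, the choice is irrelevant). -/
noncomputable def matNorm {ι : Type*} [Fintype ι] (B : Matrix ι ι ℝ) : ℝ :=
  ⨆ x : ι × ι, |B x.1 x.2|

/-- `prodA A n = A_n ⋯ A_1`. -/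
def prodA {ι : Type*} [Fintype ι] [DecidableEq ι]
    (A : ℤ → Matrix ι ι ℝ) : ℕ → Matrix ι ι ℝ
  | 0 => 1
  | n + 1 => A ((n : ℤ) + 1) * prodA A n

/-- The Lyapunov exponent `lim_n n⁻¹ log ‖B_n v‖` (as a `limsup`, in `EReal`). -/
noncomputable def lyap {ι : Type*} [Fintype ι] (B : ℕ → Matrix ι ι ℝ) (v : ι → ℝ) : EReal :=
  Filter.limsup (fun n : ℕ => ((Real.log ‖B n *ᵥ v‖ / n : ℝ) : EReal)) Filter.atTop

/-- `V̄_0 = {v : lim_n n⁻¹ log ‖B_n v‖ ≤ 0}`. -/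
def V0 {ι : Type*} [Fintype ι] (B : ℕ → Matrix ι ι ℝ) : Set (ι → ℝ) := {v | lyap B v ≤ 0}

/-- `V̄_{0-} = {v : lim_n n⁻¹ log ‖B_n v‖ < 0}`. -/
def V0minus {ι : Type*} [Fintype ι] (B : ℕ → Matrix ι ι ℝ) : Set (ι → ℝ) := {v | lyap B v < 0}

/-- `S` is a linear subspace of dimension `d`. -/
def HasDim {ι : Type*} [Fintype ι] (S : Set (ι → ℝ)) (d : ℕ) : Prop :=
  ∃ W : Submodule ℝ (ι → ℝ), (W : Set (ι → ℝ)) = S ∧ Module.finrank ℝ W = d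

/-- The `2m × 2m` matrix `A_i = [[M_i⁻¹, -σ_i],[I, 0]]` with `M_i = QΔ_i`, `N_i = Q(I - Δ_i)`,
`σ_i = M_i⁻¹ N_i`, where `p` lists the diagonal entries of `Δ_i`. -/
noncomputable def Afull {m : ℕ} (Q : Matrix (Fin m) (Fin m) ℝ) (p : Fin m → ℝ) :
    Matrix (Fin m ⊕ Fin m) (Fin m ⊕ Fin m) ℝ :=
  Matrix.fromBlocks (Q * Matrix.diagonal p)⁻¹
    (-((Q * Matrix.diagonal p)⁻¹ * (Q * (1 - Matrix.diagonal p)))) 1 0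

/-- `M̌_i = π⁽¹⁾Δ_i⁽¹⁾ + π⁽²⁾Δ_i⁽²⁾Θ`. -/
noncomputable def Mcheck {r s : ℕ} (π : Matrix (Fin r) (Fin r ⊕ Fin s) ℝ)
    (Θ : Matrix (Fin s) (Fin r) ℝ) (p : Fin r ⊕ Fin s → ℝ) : Matrix (Fin r) (Fin r) ℝ :=
  (Matrix.of fun a c => π a (Sum.inl c)) * Matrix.diagonal (fun c => p (Sum.inl c)) +
    (Matrix.of fun a b => π a (Sum.inr b)) * Matrix.diagonal (fun b => p (Sum.inr b)) * Θ

/-- `Ň_i = π⁽¹⁾(I - Δ_i⁽¹⁾) + π⁽²⁾(I - Δ_i⁽²⁾)Θ`. -/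
noncomputable def Ncheck {r s : ℕ} (π : Matrix (Fin r) (Fin r ⊕ Fin s) ℝ)
    (Θ : Matrix (Fin s) (Fin r) ℝ) (p : Fin r ⊕ Fin s → ℝ) : Matrix (Fin r) (Fin r) ℝ :=
  (Matrix.of fun a c => π a (Sum.inl c)) * (1 - Matrix.diagonal (fun c => p (Sum.inl c))) +
    (Matrix.of fun a b => π a (Sum.inr b)) * (1 - Matrix.diagonal (fun b => p (Sum.inr b))) * Θ

/-- The `2r × 2r` matrix `Ǎ_i = [[M̌_i⁻¹, -σ̌_i],[I, 0]]` with `σ̌_i = M̌_i⁻¹ Ň_i`. -/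
noncomputable def Acheck {r s : ℕ} (π : Matrix (Fin r) (Fin r ⊕ Fin s) ℝ)
    (Θ : Matrix (Fin s) (Fin r) ℝ) (p : Fin r ⊕ Fin s → ℝ) :
    Matrix (Fin r ⊕ Fin r) (Fin r ⊕ Fin r) ℝ :=
  Matrix.fromBlocks (Mcheck π Θ p)⁻¹ (-((Mcheck π Θ p)⁻¹ * Ncheck π Θ p)) 1 0

/-- The event `{𝒩_ℓ ≥ k} = {τ_ℓ^{(k)} < ∞}`: there are at least `k` visits of `X` to `ℓ`
(at times `≥ 1`). -/
def visitsAtLeast {ι : Type*} (ℓ : ℤ) (k : ℕ) : Set (ℕ → ι × ℤ) :=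
  {ω | ∃ s : Fin k → ℕ, StrictMono s ∧ ∀ j, 1 ≤ s j ∧ (ω (s j)).2 = ℓ}

/-- The event `{τ_ℓ^{(k+1)} < ∞, G_{τ_ℓ^{(k+1)}} = β}`: the walk visits `ℓ` at least `k+1` times
and the regime at the `(k+1)`-th visit is `β`. -/
def kthVisitInRegime {ι : Type*} (ℓ : ℤ) (k : ℕ) (β : ι) : Set (ℕ → ι × ℤ) :=
  {ω | ∃ s : Fin (k + 1) → ℕ, StrictMono s ∧ (∀ j, 1 ≤ s j ∧ (ω (s j)).2 = ℓ) ∧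
    (ω (s (Fin.last k))).1 = β ∧
    ∀ n : ℕ, 1 ≤ n → n ≤ s (Fin.last k) → (ω n).2 = ℓ → ∃ j, s j = n}

/-- The shift on real sequences. -/
def shiftSeq : (ℕ → ℝ) → (ℕ → ℝ) := fun x n => x (n + 1)

/-- `runningMax T f n = max_{0 ≤ k ≤ n} S_k`, where `S_k` are the Birkhoff sums of `f`. -/
noncomputable def runningMax {E : Type*} (T : E → E) (f : E → ℝ) : ℕ → E → ℝ
  | 0 => fun _ => 0
  | n + 1 => fun e => max 0 (f e + runningMax T f n (T e))

section RunningMax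

variable {E : Type*} {T : E → E} {f : E → ℝ}

theorem runningMax_nonneg (n : ℕ) (e : E) : 0 ≤ runningMax T f n e := by
  cases n with
  | zero => exact le_rfl
  | succ n => exact le_max_left _ _

theorem runningMax_mono (e : E) : Monotone fun n => runningMax T f n e := by
  refine monotone_nat_of_le_succ fun n => ?_
  induction n generalizing e with
  | zero => exact runningMax_nonneg 1 e
  | succ n ih => exact max_le_max le_rfl (add_le_add le_rfl (ih (T e)))

theorem birkhoffSum_le_runningMax (n : ℕ) (e : E) : birkhoffSum T f n e ≤ runningMax T f n e := by
  induction n generalizing e with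
  | zero => simp [runningMax]
  | succ n ih =>
    rw [birkhoffSum_succ']
    exact le_max_of_le_right (add_le_add le_rfl (ih (T e)))

theorem runningMax_iterate_add_birkhoffSum_le {e : E} {C : ℝ}
    (hC : ∀ n, birkhoffSum T f n e ≤ C) (n k : ℕ) :
    runningMax T f n (T^[k] e) + birkhoffSum T f k e ≤ C := by
  induction n generalizing k with
  | zero => simpa [runningMax] using hC k
  | succ n ih =>
    have h := ih (k + 1)
    rw [birkhoffSum_succ, Function.iterate_succ_apply'] at h
    simp only [runningMax]
    rcases max_cases 0 (f (T^[k] e) + runningMax T f n (T (T^[k] e))) with h' | h'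
    · rw [h'.1, zero_add]; exact hC k
    · rw [h'.1]; linarith

theorem bddAbove_runningMax_iff (e : E) :
    BddAbove (Set.range fun n => runningMax T f n (T e)) ↔
      BddAbove (Set.range fun n => runningMax T f n e) := by
  constructor
  · rintro ⟨C, hC⟩
    refine ⟨max 0 (f e + C), ?_⟩
    rintro _ ⟨n, rfl⟩
    cases n with
    | zero => exact le_max_left _ _
    | succ n => exact max_le_max le_rfl (add_le_add le_rfl (hC ⟨n, rfl⟩))
  · rintro ⟨C, hC⟩
    refine ⟨C - f e, ?_⟩
    rintro _ ⟨n, rfl⟩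
    have h1 : runningMax T f (n + 1) e ≤ C := hC ⟨n + 1, rfl⟩
    have h2 : f e + runningMax T f n (T e) ≤ runningMax T f (n + 1) e := le_max_right _ _
    change runningMax T f n (T e) ≤ C - f e
    linarith

variable [MeasurableSpace E] {P : Measure E}

theorem measurable_runningMax (hT : Measurable T) (hf : Measurable f) (n : ℕ) :
    Measurable (runningMax T f n) := by
  induction n with
  | zero => exact measurable_const
  | succ n ih => exact measurable_const.max (hf.add (ih.comp hT))

theorem integrable_runningMax [IsProbabilityMeasure P] (hT : MeasurePreserving T P P)
    (hf : Integrable f P) (n : ℕ) : Integrable (runningMax T f n) P := by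
  induction n with
  | zero => exact integrable_zero _ _ _
  | succ n ih =>
    exact (integrable_zero _ _ _).sup (hf.add (hT.integrable_comp_of_integrable ih))

theorem integral_max_neg_runningMax_nonneg [IsProbabilityMeasure P]
    (hT : MeasurePreserving T P P) (hf : Integrable f P) (n : ℕ) :
    0 ≤ ∫ e, max (-runningMax T f n (T e)) (f e) ∂P := by
  have hi := integrable_runningMax hT hf
  have hc : Integrable (fun e => runningMax T f n (T e)) P :=
    hT.integrable_comp_of_integrable (hi n)
  have h1 : ∀ e, max (-runningMax T f n (T e)) (f e) =
      runningMax T f (n + 1) e - runningMax T f n (T e) := by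
    intro e
    simp only [runningMax, ← max_sub_sub_right]
    congr 1 <;> ring
  simp_rw [h1]
  rw [integral_sub (hi _) hc, sub_nonneg]
  have h2 : ∫ e, runningMax T f n (T e) ∂P = ∫ e, runningMax T f n e ∂P := by
    have h := integral_map (μ := P) hT.aemeasurable
      (f := runningMax T f n) (by rw [hT.map_eq]; exact (hi n).aestronglyMeasurable)
    rw [← h, hT.map_eq]
  rw [h2]
  exact integral_mono (hi _) (hi _) fun e => runningMax_mono e n.le_succ

end RunningMax

section Ergodic

variable {E : Type*} [MeasurableSpace E] {P : Measure E} [IsProbabilityMeasure P] {T : E → E}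
  {f : E → ℝ}

/-- The Birkhoff sums of a function with negative mean are a.e. bounded above. -/
theorem ae_bddAbove_birkhoffSum (hT : Ergodic T P) (hfm : Measurable f) (hf : Integrable f P)
    (hneg : ∫ e, f e ∂P < 0) : ∀ᵐ e ∂P, ∃ C, ∀ n, birkhoffSum T f n e ≤ C := by
  have hmeas := measurable_runningMax hT.measurable hfm
  have hA : MeasurableSet {e | BddAbove (Set.range fun n => runningMax T f n e)} :=
    measurableSet_bddAbove_range hmeas
  rcases hT.toPreErgodic.ae_mem_or_ae_notMem hA (Set.ext bddAbove_runningMax_iff) with h | h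
  · filter_upwards [h] with e ⟨C, hC⟩
    exact ⟨C, fun n => (birkhoffSum_le_runningMax n e).trans (hC ⟨n, rfl⟩)⟩
  · exfalso
    have hlim : Tendsto (fun n => ∫ e, max (-runningMax T f n (T e)) (f e) ∂P) atTop
        (𝓝 (∫ e, f e ∂P)) := by
      refine tendsto_integral_of_dominated_convergence (fun e => |f e|)
        (fun n => (((hmeas n).comp hT.measurable).neg.max hfm).aestronglyMeasurable)
        hf.abs (fun n => ae_of_all _ fun e => ?_) ?_
      · have h0 := runningMax_nonneg (T := T) (f := f) n (T e)
        rw [Real.norm_eq_abs]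
        rcases max_cases (-runningMax T f n (T e)) (f e) with h' | h'
        · rw [h'.1, abs_neg, abs_of_nonneg h0, abs_of_nonpos (by linarith)]; linarith
        · rw [h'.1]
      · filter_upwards [hT.quasiMeasurePreserving.ae h] with e he
        have h1 := tendsto_atTop_atTop_of_monotone' (runningMax_mono (f := f) (T e)) he
        refine tendsto_const_nhds.congr' ?_
        filter_upwards [h1.eventually_ge_atTop (-f e)] with n hn
        rw [max_eq_right (by linarith)]
    exact absurd (ge_of_tendsto' hlim fun n =>
      integral_max_neg_runningMax_nonneg hT.toMeasurePreserving hf n) (not_le.2 hneg)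

/-- A coboundary `g - g ∘ T` that dominates an integrable function of zero mean equals it. -/
theorem ae_eq_of_le_sub_comp (hT : MeasurePreserving T P P) (hf : Integrable f P)
    (hf0 : ∫ e, f e ∂P = 0) {g : E → ℝ} (hg : Measurable g) (hg0 : ∀ e, 0 ≤ g e)
    (hfg : ∀ᵐ e ∂P, f e ≤ g e - g (T e)) : ∀ᵐ e ∂P, g e - g (T e) = f e := by
  have hgi : ∀ K : ℕ, Integrable (fun e => min (g e) K) P := fun K =>
    Integrable.of_bound (hg.min measurable_const).aestronglyMeasurable (K : ℝ)
      (ae_of_all _ fun e => by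
        rw [Real.norm_eq_abs, abs_of_nonneg (le_min (hg0 e) K.cast_nonneg)]
        exact min_le_right _ _)
  have hgTi : ∀ K : ℕ, Integrable (fun e => min (g (T e)) K) P := fun K =>
    hT.integrable_comp_of_integrable (hgi K)
  have hgK : ∀ K : ℕ, ∫ e, min (g e) K - min (g (T e)) K ∂P = 0 := by
    intro K
    rw [integral_sub (hgi K) (hgTi K), sub_eq_zero]
    have h := integral_map (μ := P) hT.aemeasurable
      (f := fun e => min (g e) (K : ℝ)) (by rw [hT.map_eq]; exact (hgi K).aestronglyMeasurable)
    rw [← h, hT.map_eq]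
  have hnegpart : Integrable (fun e => max (-f e) 0) P := hf.neg_part
  have hpospart : Integrable (fun e => max (f e) 0) P := hf.pos_part
  have hle : ∫⁻ e, ENNReal.ofReal (g e - g (T e) + max (-f e) 0) ∂P ≤
      ENNReal.ofReal (∫ e, max (-f e) 0 ∂P) := by
    have hlow : ∀ᵐ e ∂P, ∀ K : ℕ,
        0 ≤ min (g e) (K : ℝ) - min (g (T e)) K + max (-f e) 0 := by
      filter_upwards [hfg] with e he K
      have h1 := le_max_left (-f e) 0
      have h2 := le_max_right (-f e) 0
      rcases le_total (g e) (g (T e)) with h | h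
      · have : min (g (T e)) (K : ℝ) ≤ min (g e) K + (g (T e) - g e) := by
          rw [← min_add_add_right]
          exact min_le_min (by linarith) (by linarith)
        linarith
      · have := min_le_min h (le_refl (K : ℝ))
        linarith
    have hF : ∀ᵐ e ∂P, ENNReal.ofReal (g e - g (T e) + max (-f e) 0) ≤
        liminf (fun K : ℕ =>
          ENNReal.ofReal (min (g e) (K : ℝ) - min (g (T e)) K + max (-f e) 0)) atTop := by
      refine ae_of_all _ fun e => (Tendsto.liminf_eq ?_).ge
      refine tendsto_const_nhds.congr' ?_
      obtain ⟨K₀, hK₀⟩ := exists_nat_ge (max (g e) (g (T e)))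
      filter_upwards [eventually_ge_atTop K₀] with K hK
      have hK' : (K₀ : ℝ) ≤ K := by exact_mod_cast hK
      rw [min_eq_left (((le_max_left _ _).trans hK₀).trans hK'),
        min_eq_left (((le_max_right _ _).trans hK₀).trans hK')]
    refine (lintegral_mono_ae hF).trans ((lintegral_liminf_le' fun K => ?_).trans ?_)
    · exact (((hgi K).sub (hgTi K)).add hnegpart).aestronglyMeasurable.aemeasurable.ennreal_ofReal
    · have : ∀ K : ℕ, ∫⁻ e, ENNReal.ofReal
          (min (g e) (K : ℝ) - min (g (T e)) K + max (-f e) 0) ∂P =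
          ENNReal.ofReal (∫ e, max (-f e) 0 ∂P) := by
        intro K
        have hsub : Integrable (fun e => min (g e) (K : ℝ) - min (g (T e)) K) P :=
          (hgi K).sub (hgTi K)
        have hadd : Integrable
            (fun e => min (g e) (K : ℝ) - min (g (T e)) K + max (-f e) 0) P := hsub.add hnegpart
        rw [← ofReal_integral_eq_lintegral_ofReal hadd (hlow.mono fun e he => he K),
          integral_add hsub hnegpart, hgK K, zero_add]
      simp [this]
  have hparts : ∫ e, max (f e) 0 ∂P = ∫ e, max (-f e) 0 ∂P := by
    have : ∀ e, f e = max (f e) 0 - max (-f e) 0 := fun e => by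
      rcases le_total (f e) 0 with h | h
      · rw [max_eq_right h, max_eq_left (by linarith)]; ring
      · rw [max_eq_left h, max_eq_right (by linarith)]; ring
    rw [integral_congr_ae (ae_of_all _ this), integral_sub hpospart hnegpart] at hf0
    linarith
  have hle' : ∀ᵐ e ∂P, ENNReal.ofReal (max (f e) 0) ≤
      ENNReal.ofReal (g e - g (T e) + max (-f e) 0) := by
    filter_upwards [hfg] with e he
    apply ENNReal.ofReal_le_ofReal
    rcases le_total (f e) 0 with h | h
    · rw [max_eq_right h, max_eq_left (by linarith)]; linarith
    · rw [max_eq_left h, max_eq_right (by linarith)]; linarith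
  rw [← hparts, ofReal_integral_eq_lintegral_ofReal hpospart
    (ae_of_all _ fun e => le_max_right _ _)] at hle
  have heq := ae_eq_of_ae_le_of_lintegral_le hle' hpospart.lintegral_lt_top.ne
    (((hg.sub (hg.comp hT.measurable)).aemeasurable.add
      hnegpart.aestronglyMeasurable.aemeasurable).ennreal_ofReal) hle
  filter_upwards [heq, hfg] with e he h
  by_cases h0 : f e ≤ 0
  · rw [max_eq_right h0, max_eq_left (by linarith), ENNReal.ofReal_zero, eq_comm,
      ENNReal.ofReal_eq_zero] at he
    linarith
  · push Not at h0
    rw [max_eq_left h0.le, max_eq_right (by linarith), add_zero] at he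
    exact ((ENNReal.ofReal_eq_ofReal_iff h0.le (h0.le.trans h)).1 he).symm

/-- The Birkhoff sums of a function with zero mean a.e. do not diverge to `-∞`. -/
theorem ae_not_tendsto_birkhoffSum_atBot (hT : Ergodic T P) (hfm : Measurable f)
    (hf : Integrable f P) (hf0 : ∫ e, f e ∂P = 0) :
    ∀ᵐ e ∂P, ¬ Tendsto (fun n => birkhoffSum T f n e) atTop atBot := by
  have hSm : ∀ n, Measurable (birkhoffSum T f n) := fun n =>
    Finset.measurable_sum _ fun k _ => hfm.comp (hT.measurable.iterate k)
  have hD : MeasurableSet {e | Tendsto (fun n => birkhoffSum T f n e) atTop atBot} :=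
    measurableSet_tendsto _ hSm
  have hinv : T ⁻¹' {e | Tendsto (fun n => birkhoffSum T f n e) atTop atBot} =
      {e | Tendsto (fun n => birkhoffSum T f n e) atTop atBot} := by
    ext e
    simp only [Set.mem_preimage, Set.mem_ofPred_eq]
    rw [← tendsto_add_atTop_iff_nat (f := fun n => birkhoffSum T f n e) 1]
    simp_rw [birkhoffSum_succ']
    exact ⟨fun h => tendsto_atBot_add_const_left _ _ h, fun h => by
      simpa using tendsto_atBot_add_const_left _ (-f e) h⟩
  refine (hT.toPreErgodic.ae_mem_or_ae_notMem hD hinv).resolve_left fun hbot => ?_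
  have hbdd : ∀ᵐ e ∂P, ∃ C, ∀ n, birkhoffSum T f n e ≤ C := by
    filter_upwards [hbot] with e he
    obtain ⟨C, hC⟩ := bddAbove_range_of_tendsto_atTop_atBot he
    exact ⟨C, fun n => hC ⟨n, rfl⟩⟩
  set M : E → ℝ := fun e => ⨆ n, runningMax T f n e with hM
  have hMm : Measurable M := Measurable.iSup (measurable_runningMax hT.measurable hfm)
  have hMb : ∀ᵐ e ∂P, BddAbove (Set.range fun n => runningMax T f n e) := by
    filter_upwards [hbdd] with e ⟨C, hC⟩
    refine ⟨C, ?_⟩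
    rintro _ ⟨n, rfl⟩
    simpa using runningMax_iterate_add_birkhoffSum_le hC n 0
  have hM0 : ∀ e, 0 ≤ M e := fun e => Real.iSup_nonneg fun n => runningMax_nonneg n e
  have hfM : ∀ᵐ e ∂P, f e ≤ M e - M (T e) := by
    filter_upwards [hMb] with e he
    have : M (T e) ≤ M e - f e := ciSup_le fun n => by
      have h1 : runningMax T f (n + 1) e ≤ M e := le_ciSup he (n + 1)
      have h2 : f e + runningMax T f n (T e) ≤ runningMax T f (n + 1) e := le_max_right _ _
      linarith
    linarith
  have hcob := ae_eq_of_le_sub_comp hT.toMeasurePreserving hf hf0 hMm hM0 hfM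
  have hcob' : ∀ᵐ e ∂P, ∀ n, birkhoffSum T f n e = M e - M (T^[n] e) := by
    have hall : ∀ᵐ e ∂P, ∀ n, M (T^[n] e) - M (T (T^[n] e)) = f (T^[n] e) :=
      ae_all_iff.2 fun n => (hT.quasiMeasurePreserving.iterate n).ae hcob
    filter_upwards [hall] with e he n
    induction n with
    | zero => simp
    | succ n ih =>
      rw [birkhoffSum_succ, ih, ← he n, Function.iterate_succ_apply']; ring
  have hrec : ∀ᵐ e ∂P, ∀ K : ℕ, e ∈ {x | M x ≤ K} → ∃ᶠ n in atTop, T^[n] e ∈ {x | M x ≤ K} :=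
    ae_all_iff.2 fun K => hT.toMeasurePreserving.conservative.ae_mem_imp_frequently_image_mem
      (measurableSet_le hMm measurable_const).nullMeasurableSet
  obtain ⟨e, h1, h2, h3⟩ := (hbot.and (hcob'.and hrec)).exists
  obtain ⟨K, hK⟩ := exists_nat_ge (M e)
  refine h3 K hK ?_
  filter_upwards [(tendsto_atBot.1 h1) (M e - K - 1)] with n hn hmem
  rw [h2 n] at hn
  have : M (T^[n] e) ≤ K := hmem
  linarith

/-- If the negative part of `f` outweighs its positive part, then the Birkhoff sums of `f` a.e.
decrease at least linearly. -/
theorem ae_birkhoffSum_le_linear (hT : Ergodic T P) (hfm : Measurable f)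
    (hlt : ∫⁻ e, ENNReal.ofReal (f e) ∂P < ∫⁻ e, ENNReal.ofReal (-f e) ∂P) :
    ∃ ε > 0, ∀ᵐ e ∂P, ∃ C, ∀ n : ℕ, birkhoffSum T f n e ≤ C - ε * n := by
  have hsup : ∫⁻ e, ENNReal.ofReal (-f e) ∂P =
      ⨆ M : ℕ, ∫⁻ e, ENNReal.ofReal (-max (f e) (-M)) ∂P := by
    rw [← lintegral_iSup]
    · refine lintegral_congr fun e => le_antisymm ?_ (iSup_le fun M => ?_)
      · obtain ⟨M, hM⟩ := exists_nat_ge (-f e)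
        refine le_iSup_of_le M ?_
        rw [max_eq_left (by linarith)]
      · exact ENNReal.ofReal_le_ofReal (neg_le_neg (le_max_left _ _))
    · exact fun M => (hfm.max measurable_const).neg.ennreal_ofReal
    · intro M N hMN e
      have : (M : ℝ) ≤ N := by exact_mod_cast hMN
      exact ENNReal.ofReal_le_ofReal (neg_le_neg (max_le_max le_rfl (neg_le_neg this)))
  rw [hsup] at hlt
  obtain ⟨M, hM⟩ := lt_iSup_iff.1 hlt
  have hpos : ∫⁻ e, ENNReal.ofReal (max (f e) (-M)) ∂P = ∫⁻ e, ENNReal.ofReal (f e) ∂P := by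
    refine lintegral_congr fun e => ?_
    have hM0 : (0 : ℝ) ≤ M := M.cast_nonneg
    rcases le_total (f e) (-M) with h | h
    · rw [max_eq_right h, ENNReal.ofReal_of_nonpos (by linarith),
        ENNReal.ofReal_of_nonpos (by linarith)]
    · rw [max_eq_left h]
  have hgm : Measurable fun e => max (f e) (-(M : ℝ)) := hfm.max measurable_const
  have hneglt : ∫⁻ e, ENNReal.ofReal (-max (f e) (-M)) ∂P < ⊤ := by
    refine (lintegral_mono fun e => ENNReal.ofReal_le_ofReal
      (neg_le_neg (le_max_right _ _))).trans_lt ?_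
    simp
  have hgi : Integrable (fun e => max (f e) (-(M : ℝ))) P := by
    refine ⟨hgm.aestronglyMeasurable, ?_⟩
    rw [hasFiniteIntegral_iff_norm]
    have hle : ∀ e, ENNReal.ofReal ‖max (f e) (-(M : ℝ))‖ ≤
        ENNReal.ofReal (max (f e) (-M)) + ENNReal.ofReal (-max (f e) (-M)) := by
      intro e
      rcases le_total 0 (max (f e) (-(M : ℝ))) with h | h
      · rw [Real.norm_of_nonneg h]; exact le_self_add
      · rw [Real.norm_of_nonpos h]; exact le_add_self
    refine (lintegral_mono hle).trans_lt ?_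
    rw [lintegral_add_left hgm.ennreal_ofReal, hpos]
    exact ENNReal.add_lt_top.2 ⟨hM.trans hneglt, hneglt⟩
  have hint : ∫ e, max (f e) (-(M : ℝ)) ∂P < 0 := by
    rw [integral_eq_lintegral_pos_part_sub_lintegral_neg_part hgi, hpos, sub_neg]
    exact (ENNReal.toReal_lt_toReal (hM.trans hneglt).ne hneglt.ne).2 hM
  set ε := -(∫ e, max (f e) (-(M : ℝ)) ∂P) / 2 with hε
  refine ⟨ε, by linarith, ?_⟩
  have hh := ae_bddAbove_birkhoffSum hT (hgm.add_const ε) (hgi.add (integrable_const ε)) (by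
    rw [integral_add hgi (integrable_const ε)]
    simp only [integral_const, probReal_univ, one_smul]
    linarith)
  filter_upwards [hh] with e ⟨C, hC⟩
  refine ⟨C, fun n => ?_⟩
  have h1 : birkhoffSum T f n e + ε * n ≤
      birkhoffSum T (fun e => max (f e) (-(M : ℝ)) + ε) n e := by
    simp only [birkhoffSum, Finset.sum_add_distrib, Finset.sum_const, Finset.card_range,
      nsmul_eq_mul]
    rw [mul_comm ε]
    exact add_le_add (Finset.sum_le_sum fun k _ => le_max_left _ _) le_rfl
  linarith [hC n]

/-- Version of `ae_not_tendsto_birkhoffSum_atBot` with the mean expressed by lower integrals. -/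
theorem ae_not_tendsto_birkhoffSum_atBot_of_lintegral (hT : Ergodic T P) (hfm : Measurable f)
    (htop : ∫⁻ e, ENNReal.ofReal (f e) ∂P ≠ ⊤)
    (heq : ∫⁻ e, ENNReal.ofReal (f e) ∂P = ∫⁻ e, ENNReal.ofReal (-f e) ∂P) :
    ∀ᵐ e ∂P, ¬ Tendsto (fun n => birkhoffSum T f n e) atTop atBot := by
  have hfi : Integrable f P := by
    refine ⟨hfm.aestronglyMeasurable, ?_⟩
    rw [hasFiniteIntegral_iff_norm]
    have hle : ∀ e, ENNReal.ofReal ‖f e‖ ≤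
        ENNReal.ofReal (f e) + ENNReal.ofReal (-f e) := by
      intro e
      rcases le_total 0 (f e) with h | h
      · rw [Real.norm_of_nonneg h]; exact le_self_add
      · rw [Real.norm_of_nonpos h]; exact le_add_self
    refine (lintegral_mono hle).trans_lt ?_
    rw [lintegral_add_left hfm.ennreal_ofReal, ← heq]
    exact ENNReal.add_lt_top.2 ⟨htop.lt_top, htop.lt_top⟩
  refine ae_not_tendsto_birkhoffSum_atBot hT hfm hfi ?_
  rw [integral_eq_lintegral_pos_part_sub_lintegral_neg_part hfi, heq, sub_self]

end Ergodic

section TwoSided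

/-- The shift on two-sided real sequences. -/
def shiftEquiv : (ℤ → ℝ) ≃ᵐ (ℤ → ℝ) where
  toFun x k := x (k + 1)
  invFun x k := x (k - 1)
  left_inv x := by simp
  right_inv x := by simp
  measurable_toFun := measurable_pi_lambda _ fun _ => measurable_pi_apply _
  measurable_invFun := measurable_pi_lambda _ fun _ => measurable_pi_apply _

theorem shiftEquiv_iterate (n : ℕ) (x : ℤ → ℝ) (k : ℤ) :
    (shiftEquiv^[n] x) k = x (k + n) := by
  induction n generalizing x with
  | zero => simp
  | succ n ih =>
    rw [Function.iterate_succ_apply, ih]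
    change x (k + n + 1) = _
    congr 1; push_cast; ring

theorem shiftEquiv_symm_iterate (n : ℕ) (x : ℤ → ℝ) (k : ℤ) :
    (shiftEquiv.symm^[n] x) k = x (k - n) := by
  induction n generalizing x with
  | zero => simp
  | succ n ih =>
    rw [Function.iterate_succ_apply, ih]
    change x (k - n - 1) = _
    congr 1; push_cast; ring

variable {E : Type*} [MeasurableSpace E] {P : Measure E} {T : E → E} {f : ℤ → E → ℝ}

theorem ergodic_shiftEquiv (hT : Ergodic T P) (hfm : ∀ k, Measurable (f k))
    (hfT : ∀ k e, f k (T e) = f (k + 1) e) :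
    Ergodic shiftEquiv (P.map fun e k => f k e) := by
  have hm : Measurable fun e k => f k e := measurable_pi_lambda _ hfm
  refine (hm.measurePreserving P).ergodic_of_ergodic_semiconj hT shiftEquiv.measurable fun e => ?_
  funext k
  exact hfT k e

theorem lintegral_map_eval (hfm : ∀ k, Measurable (f k)) {φ : ℝ → ℝ≥0∞} (hφ : Measurable φ)
    (j : ℤ) : ∫⁻ x, φ (x j) ∂(P.map fun e k => f k e) = ∫⁻ e, φ (f j e) ∂P :=
  lintegral_map (hφ.comp (measurable_pi_apply j)) (measurable_pi_lambda _ hfm)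

theorem lintegral_map_eval_one (hT : MeasurePreserving T P P) (hfm : ∀ k, Measurable (f k))
    (hfT : ∀ k e, f k (T e) = f (k + 1) e) {φ : ℝ → ℝ≥0∞} (hφ : Measurable φ) :
    ∫⁻ x, φ (x 1) ∂(P.map fun e k => f k e) = ∫⁻ e, φ (f 0 e) ∂P := by
  have h : ∀ e, φ (f 1 e) = φ (f 0 (T e)) := fun e => by rw [hfT, zero_add]
  rw [lintegral_map_eval hfm hφ, lintegral_congr h]
  exact hT.lintegral_comp (hφ.comp (hfm 0))

variable [IsProbabilityMeasure P]

/-- Stationary two-sided sequences with negative mean: partial sums in both directions decrease at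
least linearly. -/
theorem ae_sum_le_linear (hT : Ergodic T P) (hfm : ∀ k, Measurable (f k))
    (hfT : ∀ k e, f k (T e) = f (k + 1) e)
    (hlt : ∫⁻ e, ENNReal.ofReal (f 0 e) ∂P < ∫⁻ e, ENNReal.ofReal (-f 0 e) ∂P) :
    ∀ᵐ e ∂P, (∃ ε > 0, ∃ C, ∀ n : ℕ, ∑ k ∈ Finset.range n, f (k + 1) e ≤ C - ε * n) ∧
      ∃ ε > 0, ∃ C, ∀ n : ℕ, ∑ k ∈ Finset.range n, f (-k) e ≤ C - ε * n := by
  have hm : Measurable fun e k => f k e := measurable_pi_lambda _ hfm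
  have := Measure.isProbabilityMeasure_map (μ := P) hm.aemeasurable
  have herg := ergodic_shiftEquiv hT hfm hfT
  have hn : Measurable fun x : ℝ => ENNReal.ofReal (-x) := measurable_neg.ennreal_ofReal
  obtain ⟨ε₁, hε₁, h1⟩ := ae_birkhoffSum_le_linear herg (f := fun x => x 1)
    (measurable_pi_apply 1) (by
      rwa [lintegral_map_eval_one hT.toMeasurePreserving hfm hfT ENNReal.measurable_ofReal,
        lintegral_map_eval_one hT.toMeasurePreserving hfm hfT hn])
  obtain ⟨ε₂, hε₂, h2⟩ := ae_birkhoffSum_le_linear herg.symm (f := fun x => x 0)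
    (measurable_pi_apply 0) (by
      rwa [lintegral_map_eval hfm ENNReal.measurable_ofReal,
        lintegral_map_eval hfm hn])
  filter_upwards [ae_of_ae_map hm.aemeasurable h1, ae_of_ae_map hm.aemeasurable h2]
    with e ⟨C₁, hC₁⟩ ⟨C₂, hC₂⟩
  refine ⟨⟨ε₁, hε₁, C₁, fun n => ?_⟩, ε₂, hε₂, C₂, fun n => ?_⟩
  · simpa [birkhoffSum, shiftEquiv_iterate, add_comm] using hC₁ n
  · simpa [birkhoffSum, shiftEquiv_symm_iterate] using hC₂ n

/-- Stationary two-sided sequences with zero mean: partial sums do not diverge to `-∞`. -/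
theorem ae_not_tendsto_sum_atBot (hT : Ergodic T P) (hfm : ∀ k, Measurable (f k))
    (hfT : ∀ k e, f k (T e) = f (k + 1) e)
    (htop : ∫⁻ e, ENNReal.ofReal (f 0 e) ∂P ≠ ⊤)
    (heq : ∫⁻ e, ENNReal.ofReal (f 0 e) ∂P = ∫⁻ e, ENNReal.ofReal (-f 0 e) ∂P) :
    ∀ᵐ e ∂P, (¬ Tendsto (fun n => ∑ k ∈ Finset.range n, f (k + 1) e) atTop atBot) ∧
      ¬ Tendsto (fun n => ∑ k ∈ Finset.range n, f (-k) e) atTop atBot := by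
  have hm : Measurable fun e k => f k e := measurable_pi_lambda _ hfm
  have := Measure.isProbabilityMeasure_map (μ := P) hm.aemeasurable
  have herg := ergodic_shiftEquiv hT hfm hfT
  have hn : Measurable fun x : ℝ => ENNReal.ofReal (-x) := measurable_neg.ennreal_ofReal
  have h1 := ae_not_tendsto_birkhoffSum_atBot_of_lintegral herg (f := fun x => x 1)
    (measurable_pi_apply 1) (by
      rwa [lintegral_map_eval_one hT.toMeasurePreserving hfm hfT ENNReal.measurable_ofReal]) (by
      rwa [lintegral_map_eval_one hT.toMeasurePreserving hfm hfT ENNReal.measurable_ofReal,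
        lintegral_map_eval_one hT.toMeasurePreserving hfm hfT hn])
  have h2 := ae_not_tendsto_birkhoffSum_atBot_of_lintegral herg.symm (f := fun x => x 0)
    (measurable_pi_apply 0) (by
      rwa [lintegral_map_eval hfm ENNReal.measurable_ofReal]) (by
      rwa [lintegral_map_eval hfm ENNReal.measurable_ofReal,
        lintegral_map_eval hfm hn])
  filter_upwards [ae_of_ae_map hm.aemeasurable h1, ae_of_ae_map hm.aemeasurable h2] with e h1 h2
  constructor
  · simpa [birkhoffSum, shiftEquiv_iterate, add_comm] using h1
  · simpa [birkhoffSum, shiftEquiv_symm_iterate] using h2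

end TwoSided

section Scale

theorem exists_antidifference (g : ℤ → ℝ) : ∃ G : ℤ → ℝ, ∀ x, G (x + 1) = G x + g x := by
  refine ⟨fun x => ∑ k ∈ Finset.range x.toNat, g k -
    ∑ k ∈ Finset.range (-x).toNat, g (-1 - k), fun x => ?_⟩
  rcases lt_or_ge x 0 with hx | hx
  · obtain ⟨n, hn⟩ : ∃ n : ℕ, x = -(n + 1) := ⟨(-x - 1).toNat, by omega⟩
    subst hn
    have e1 : (-((n : ℤ) + 1) + 1).toNat = 0 := by omega
    have e2 : (-(-((n : ℤ) + 1) + 1)).toNat = n := by omega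
    have e3 : (-((n : ℤ) + 1)).toNat = 0 := by omega
    have e4 : (-(-((n : ℤ) + 1))).toNat = n + 1 := by omega
    simp only [e1, e2, e3, e4, Finset.sum_range_succ, Finset.range_zero, Finset.sum_empty]
    rw [show -1 - (n : ℤ) = -(n + 1) by ring]
    ring
  · obtain ⟨n, rfl⟩ := Int.eq_ofNat_of_zero_le hx
    have e1 : ((n : ℤ) + 1).toNat = n + 1 := by omega
    have e2 : (-((n : ℤ) + 1)).toNat = 0 := by omega
    have e3 : (-(n : ℤ)).toNat = 0 := by omega
    simp only [e1, e2, e3, Int.toNat_natCast, Finset.sum_range_succ]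
    ring

variable {G g : ℤ → ℝ}

theorem antidifference_natCast (h : ∀ x, G (x + 1) = G x + g x) (n : ℕ) :
    G n = G 0 + ∑ k ∈ Finset.range n, g k := by
  induction n with
  | zero => simp
  | succ n ih => rw [Finset.sum_range_succ, ← add_assoc, ← ih]; exact_mod_cast h n

theorem antidifference_neg_natCast (h : ∀ x, G (x + 1) = G x + g x) (n : ℕ) :
    G (-n) = G 0 - ∑ k ∈ Finset.range n, g (-1 - k) := by
  induction n with
  | zero => simp
  | succ n ih =>
    have := h (-1 - n)
    rw [show (-1 - n + 1 : ℤ) = -n by ring] at this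
    rw [Finset.sum_range_succ, show (-((n + 1 : ℕ) : ℤ)) = -1 - n by push_cast; ring]
    linarith

variable {s w : ℤ → ℝ}

theorem strictMono_of_antidifference (h : ∀ x, s (x + 1) = s x + w x) (hw : ∀ x, 0 < w x) :
    StrictMono s :=
  strictMono_int_of_lt_succ fun x => by rw [h]; linarith [hw x]

theorem exists_le_of_antidifference (h : ∀ x, s (x + 1) = s x + w x) (hw : ∀ x, 0 < w x)
    {ε C : ℝ} (hε : 0 < ε) (hC : ∀ n : ℕ, w n ≤ Real.exp (C - ε * n)) :
    ∃ c, ∀ x, s x ≤ c := by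
  have hsum : Summable fun n : ℕ => Real.exp (C - ε * n) := by
    have := (Real.summable_exp_nat_mul_iff (a := -ε)).2 (by linarith)
    refine (this.mul_left (Real.exp C)).congr fun n => ?_
    rw [← Real.exp_add]; congr 1; ring
  have hsw : Summable fun n : ℕ => w n := hsum.of_nonneg_of_le (fun n => (hw n).le) hC
  refine ⟨s 0 + ∑' n : ℕ, w n, fun x => ?_⟩
  refine ((strictMono_of_antidifference h hw).monotone (Int.self_le_toNat x)).trans ?_
  rw [antidifference_natCast h]
  exact add_le_add le_rfl (hsw.sum_le_tsum _ fun n _ => (hw n).le)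

theorem tendsto_atTop_of_antidifference (h : ∀ x, s (x + 1) = s x + w x) (hw : ∀ x, 0 < w x)
    (hC : ¬ Tendsto (fun n : ℕ => w n) atTop (𝓝 0)) : Tendsto s atTop atTop := by
  have hns : ¬ Summable fun n : ℕ => w n := fun hs => hC hs.tendsto_atTop_zero
  have ht := (not_summable_iff_tendsto_nat_atTop_of_nonneg fun n => (hw n).le).1 hns
  refine tendsto_atTop_atTop_of_monotone (strictMono_of_antidifference h hw).monotone fun b => ?_
  obtain ⟨n, hn⟩ := (ht.eventually_ge_atTop (b - s 0)).exists
  refine ⟨n, ?_⟩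
  rw [antidifference_natCast h]
  linarith

/-- A strictly increasing harmonic function for the nearest-neighbour walk with up-probabilities
`r`; its behaviour at `±∞` is controlled by the partial sums of `f = log ((1 - r) / r)`. -/
theorem exists_scale_function (r : ℤ → ℝ) (hr : ∀ x, r x ∈ Set.Ioo (0 : ℝ) 1) (f : ℤ → ℝ)
    (hf : ∀ x, f x = Real.log ((1 - r x) / r x)) :
    ∃ s : ℤ → ℝ, StrictMono s ∧ (∀ x, r x * s (x + 1) + (1 - r x) * s (x - 1) = s x) ∧
      ((∃ ε > 0, ∃ C, ∀ n : ℕ, ∑ k ∈ Finset.range n, f (k + 1) ≤ C - ε * n) →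
        ∃ c, ∀ x, s x ≤ c) ∧
      ((¬ Tendsto (fun n => ∑ k ∈ Finset.range n, f (k + 1)) atTop atBot) →
        Tendsto s atTop atTop) ∧
      ((∃ ε > 0, ∃ C, ∀ n : ℕ, ∑ k ∈ Finset.range n, -f (-k) ≤ C - ε * n) →
        ∃ c, ∀ x, c ≤ s x) ∧
      ((¬ Tendsto (fun n => ∑ k ∈ Finset.range n, -f (-k)) atTop atBot) →
        Tendsto s atBot atBot) := by
  obtain ⟨V, hV⟩ := exists_antidifference fun x => f (x + 1)
  obtain ⟨s, hs⟩ := exists_antidifference fun x => Real.exp (V x)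
  have hw : ∀ x, 0 < Real.exp (V x) := fun x => Real.exp_pos _
  have hs' : ∀ x, -s (-(x + 1)) = -s (-x) + Real.exp (V (-x - 1)) := fun x => by
    have := hs (-x - 1)
    rw [show -x - 1 + 1 = -x by ring] at this
    rw [show -(x + 1) = -x - 1 by ring, this]
    ring
  have hw' : ∀ x, 0 < Real.exp (V (-x - 1)) := fun x => Real.exp_pos _
  have hVp := antidifference_natCast hV
  have hVn : ∀ n : ℕ, V (-n) = V 0 + ∑ k ∈ Finset.range n, -f (-k) := fun n => by
    rw [antidifference_neg_natCast hV, Finset.sum_neg_distrib, ← sub_eq_add_neg]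
    congr 1
    refine Finset.sum_congr rfl fun k _ => ?_
    congr 1; ring
  have hVn' : ∀ n : ℕ, V (-n - 1) = V 0 + ∑ k ∈ Finset.range (n + 1), -f (-k) := fun n => by
    rw [← hVn]; congr 1; push_cast; ring
  refine ⟨s, strictMono_of_antidifference hs hw, fun x => ?_, ?_, ?_, ?_, ?_⟩
  · have h1 := hs (x - 1)
    have h2 := hV (x - 1)
    have h0 := (hr x).1
    have h0' : 0 < 1 - r x := by linarith [(hr x).2]
    simp only [sub_add_cancel] at h1 h2
    rw [hf] at h2
    have h3 : r x * Real.exp (V x) = (1 - r x) * Real.exp (V (x - 1)) := by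
      rw [h2, Real.exp_add, Real.exp_log (div_pos h0' h0)]
      field_simp
    rw [hs x]
    linear_combination h3 - (1 - r x) * h1
  · rintro ⟨ε, hε, C, hC⟩
    refine exists_le_of_antidifference hs hw (C := V 0 + C) hε fun n => ?_
    rw [Real.exp_le_exp, hVp]
    linarith [hC n]
  · intro h
    refine tendsto_atTop_of_antidifference hs hw fun h0 => h ?_
    have h1 := Real.tendsto_exp_comp_nhds_zero.1 h0
    simp_rw [hVp] at h1
    simpa using tendsto_atBot_add_const_left _ (-V 0) h1
  · rintro ⟨ε, hε, C, hC⟩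
    obtain ⟨c, hc⟩ := exists_le_of_antidifference (s := fun x => -s (-x)) hs' hw'
        (C := V 0 + C) hε fun n => by
      rw [Real.exp_le_exp, hVn']
      have := hC (n + 1)
      push_cast at this
      linarith
    refine ⟨-c, fun x => ?_⟩
    have := hc (-x)
    rw [neg_neg] at this
    linarith
  · intro h
    have h2 := tendsto_atTop_of_antidifference (s := fun x => -s (-x)) hs' hw' fun h0 => h (by
      have h1 := Real.tendsto_exp_comp_nhds_zero.1 h0
      simp_rw [hVn'] at h1
      rw [← tendsto_add_atTop_iff_nat 1]
      simpa using tendsto_atBot_add_const_left _ (-V 0) h1)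
    have h3 := tendsto_neg_atTop_atBot.comp (h2.comp (tendsto_neg_atBot_atTop (G := ℤ)))
    refine h3.congr fun x => ?_
    simp

end Scale

section Path

/-- A nearest-neighbour path along which a strictly increasing function converges while being
divergent at `-∞` must itself diverge to `+∞`. -/
theorem tendsto_atTop_of_scale_tendsto {s : ℤ → ℝ} (hs : StrictMono s)
    (hbot : Tendsto s atBot atBot) {x : ℕ → ℤ}
    (hx : ∀ n, x (n + 1) = x n + 1 ∨ x (n + 1) = x n - 1) {L : ℝ}
    (hL : Tendsto (fun n => s (x n)) atTop (𝓝 L)) : Tendsto x atTop atTop := by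
  obtain ⟨a, ha⟩ := (hbot.eventually_lt_atBot (L - 1)).exists
  have hlow : ∀ᶠ n in atTop, a < x n := by
    filter_upwards [hL.eventually_const_lt (show L - 1 < L by linarith)] with n hn
    exact hs.lt_iff_lt.1 (ha.trans hn)
  refine tendsto_atTop.2 fun b => ?_
  have hδ : ∃ δ > 0, ∀ y ∈ Finset.Icc a b, δ ≤ s (y + 1) - s y ∧ δ ≤ s y - s (y - 1) := by
    rcases (Finset.Icc a b).eq_empty_or_nonempty with h | h
    · exact ⟨1, one_pos, by simp [h]⟩
    · obtain ⟨y, -, hy⟩ := (Finset.Icc a b).exists_min_image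
        (fun y => min (s (y + 1) - s y) (s y - s (y - 1))) h
      refine ⟨min (s (y + 1) - s y) (s y - s (y - 1)), lt_min ?_ ?_, fun z hz =>
        ⟨(hy z hz).trans (min_le_left _ _), (hy z hz).trans (min_le_right _ _)⟩⟩
      · exact sub_pos.2 (hs (by omega))
      · exact sub_pos.2 (hs (by omega))
  obtain ⟨δ, hδ0, hδ⟩ := hδ
  have hdiff : Tendsto (fun n => s (x (n + 1)) - s (x n)) atTop (𝓝 0) := by
    simpa using ((tendsto_add_atTop_iff_nat 1).2 hL).sub hL
  have hsmall : ∀ᶠ n in atTop, |s (x (n + 1)) - s (x n)| < δ := by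
    simpa [Real.dist_eq] using hdiff.eventually (Metric.ball_mem_nhds 0 hδ0)
  filter_upwards [hlow, hsmall] with n h1 h2
  by_contra! h
  obtain ⟨h3, h4⟩ := hδ (x n) (Finset.mem_Icc.2 ⟨h1.le, h.le⟩)
  rw [abs_lt] at h2
  rcases hx n with h5 | h5 <;> rw [h5] at h2 <;> linarith [h2.1, h2.2]

theorem tendsto_atBot_of_scale_tendsto {s : ℤ → ℝ} (hs : StrictMono s)
    (htop : Tendsto s atTop atTop) {x : ℕ → ℤ}
    (hx : ∀ n, x (n + 1) = x n + 1 ∨ x (n + 1) = x n - 1) {L : ℝ}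
    (hL : Tendsto (fun n => s (x n)) atTop (𝓝 L)) : Tendsto x atTop atBot := by
  have h := tendsto_atTop_of_scale_tendsto (s := fun y => -s (-y)) (x := fun n => -x n) (L := -L)
    (fun a b hab => neg_lt_neg (hs (neg_lt_neg hab)))
    (tendsto_neg_atTop_atBot.comp (htop.comp tendsto_neg_atBot_atTop))
    (fun n => by rcases hx n with h | h <;> rw [h] <;> [right; left] <;> ring)
    (by simpa using hL.neg)
  exact (tendsto_neg_atTop_atBot.comp h).congr fun n => neg_neg (x n)

end Path

/-- The cylinder of paths agreeing with `traj` up to time `n`. -/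
def cylinderUpTo {S : Type*} (n : ℕ) (traj : ℕ → S) : Set (ℕ → S) :=
  {ω | ∀ k ≤ n, ω k = traj k}

lemma measurableSet_cylinderUpTo {S : Type*} [MeasurableSpace S] [MeasurableSingletonClass S]
    (n : ℕ) (traj : ℕ → S) : MeasurableSet (cylinderUpTo n traj) := by
  have : cylinderUpTo n traj = ⋂ k ∈ Finset.range (n + 1), (fun ω : ℕ → S => ω k) ⁻¹' {traj k} := by
    ext ω
    simp [cylinderUpTo]
  rw [this]
  exact Finset.measurableSet_biInter _ fun k _ =>
    (measurable_pi_apply k) (measurableSet_singleton _)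

lemma measurableSet_coord_eq {S : Type*} [MeasurableSpace S] [MeasurableSingletonClass S]
    (n : ℕ) (y : S) : MeasurableSet {ω : ℕ → S | ω n = y} :=
  measurable_pi_apply (X := fun _ : ℕ => S) n (measurableSet_singleton y)

lemma exists_countable_cylinderUpTo_cover {S : Type*} [Countable S] [Nonempty S] (n : ℕ) :
    ∃ t : (Set.Iic n → S) → ℕ → S,
      ∀ ω : ℕ → S, ∀ w, ω ∈ cylinderUpTo n (t w) ↔ Preorder.restrictLe n ω = w := by
  classical
  refine ⟨fun w k => if h : k ≤ n then w ⟨k, h⟩ else Classical.arbitrary S, fun ω w => ?_⟩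
  constructor
  · intro h
    funext k
    have := h k.1 k.2
    simp only [dif_pos (show k.1 ≤ n from k.2)] at this
    exact this
  · rintro rfl k hk
    simp [hk]

lemma step_nonneg {m : ℕ} {Q : Matrix (Fin m) (Fin m) ℝ} {p : Fin m → ℤ → ℝ}
    (hQ : ∀ α β, 0 ≤ Q α β) (hp : ∀ α k, p α k ∈ Set.Ioo (0 : ℝ) 1) (x y : Fin m × ℤ) :
    0 ≤ step Q p x y := by
  unfold step
  refine mul_nonneg (hQ _ _) ?_
  have := hp y.1 x.2
  split_ifs
  · exact this.1.le
  · linarith [this.2]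
  · exact le_rfl

section Quenched

variable {m : ℕ} {Q : Matrix (Fin m) (Fin m) ℝ} {p : Fin m → ℤ → ℝ}
  {μ : Fin m → ℤ → Measure (ℕ → Fin m × ℤ)}

lemma IsQuenchedLaw.measure_cylinder_inter (hμ : IsQuenchedLaw Q p μ)
    (hQ : ∀ α β, 0 ≤ Q α β) (hp : ∀ α k, p α k ∈ Set.Ioo (0 : ℝ) 1)
    (α : Fin m) (i : ℤ) (n : ℕ) (traj : ℕ → Fin m × ℤ) (y : Fin m × ℤ) :
    μ α i (cylinderUpTo n traj ∩ {ω | ω (n + 1) = y}) =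
      μ α i (cylinderUpTo n traj) * ENNReal.ofReal (step Q p (traj n) y) := by
  have hset : cylinderUpTo n traj ∩ {ω | ω (n + 1) = y} =
      {ω | ∀ k ≤ n + 1, ω k = Function.update traj (n + 1) y k} := by
    ext ω
    constructor
    · rintro ⟨h1, h2⟩ k hk
      rcases Nat.lt_or_eq_of_le hk with h | rfl
      · rw [Function.update_of_ne h.ne]
        exact h1 k (Nat.lt_succ_iff.1 h)
      · simpa using h2
    · intro h
      refine ⟨fun k hk => ?_, ?_⟩
      · have := h k (by omega)
        rwa [Function.update_of_ne (by omega)] at this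
      · simpa using h (n + 1) le_rfl
  have hprod : ∏ k ∈ Finset.range n, step Q p (Function.update traj (n + 1) y k)
      (Function.update traj (n + 1) y (k + 1)) =
      ∏ k ∈ Finset.range n, step Q p (traj k) (traj (k + 1)) := by
    refine Finset.prod_congr rfl fun k hk => ?_
    have := Finset.mem_range.1 hk
    rw [Function.update_of_ne (by omega), Function.update_of_ne (by omega)]
  rw [hset, (hμ α i).2, cylinderUpTo, (hμ α i).2, Finset.prod_range_succ, hprod,
    ENNReal.ofReal_mul (Finset.prod_nonneg fun k _ => step_nonneg hQ hp _ _), ← mul_assoc,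
    Function.update_of_ne (by omega), Function.update_of_ne (by omega), Function.update_self]

lemma IsQuenchedLaw.ae_start (hμ : IsQuenchedLaw Q p μ) (α : Fin m) (i : ℤ) :
    ∀ᵐ ω ∂μ α i, ω 0 = (α, i) := by
  have := (hμ α i).1
  have h := (hμ α i).2 0 fun _ => (α, i)
  simp only [Nat.le_zero, forall_eq, if_true, Finset.range_zero, Finset.prod_empty,
    ENNReal.ofReal_one, mul_one] at h
  rw [← prob_compl_eq_zero_iff (measurableSet_coord_eq 0 (α, i))] at h
  exact h

lemma IsQuenchedLaw.ae_cylinder_step (hμ : IsQuenchedLaw Q p μ)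
    (hQ : ∀ α β, 0 ≤ Q α β) (hp : ∀ α k, p α k ∈ Set.Ioo (0 : ℝ) 1)
    (α : Fin m) (i : ℤ) (n : ℕ) (traj : ℕ → Fin m × ℤ) :
    ∀ᵐ ω ∂μ α i, ω ∈ cylinderUpTo n traj →
      ((ω (n + 1)).2 = (traj n).2 + 1 ∨ (ω (n + 1)).2 = (traj n).2 - 1) := by
  have h : ∀ y : Fin m × ℤ, ∀ᵐ ω ∂μ α i, ω ∈ cylinderUpTo n traj → ω (n + 1) = y →
      (y.2 = (traj n).2 + 1 ∨ y.2 = (traj n).2 - 1) := by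
    intro y
    by_cases hy : y.2 = (traj n).2 + 1 ∨ y.2 = (traj n).2 - 1
    · exact Eventually.of_forall fun _ _ _ => hy
    · have h0 := hμ.measure_cylinder_inter hQ hp α i n traj y
      have hs : step Q p (traj n) y = 0 := by
        rw [not_or] at hy
        simp [step, hy.1, hy.2]
      rw [hs, ENNReal.ofReal_zero, mul_zero] at h0
      filter_upwards [compl_mem_ae_iff.2 h0] with ω hω h1 h2
      exact absurd ⟨h1, h2⟩ hω
  filter_upwards [ae_all_iff.2 h] with ω hω h1
  exact hω _ h1 rfl

lemma IsQuenchedLaw.ae_nearest_neighbour (hμ : IsQuenchedLaw Q p μ)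
    (hQ : ∀ α β, 0 ≤ Q α β) (hp : ∀ α k, p α k ∈ Set.Ioo (0 : ℝ) 1)
    (α : Fin m) (i : ℤ) :
    ∀ᵐ ω ∂μ α i, ∀ n, (ω (n + 1)).2 = (ω n).2 + 1 ∨ (ω (n + 1)).2 = (ω n).2 - 1 := by
  refine ae_all_iff.2 fun n => ?_
  have : Nonempty (Fin m × ℤ) := ⟨(α, i)⟩
  obtain ⟨t, ht⟩ := exists_countable_cylinderUpTo_cover (S := Fin m × ℤ) n
  filter_upwards [ae_all_iff.2 fun w => hμ.ae_cylinder_step hQ hp α i n (t w)] with ω hω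
  have hmem := (ht ω _).2 rfl
  have := hω _ hmem
  rwa [← hmem n le_rfl] at this

/-- A function harmonic for the averaged walk is preserved in the mean on every cylinder. -/
lemma IsQuenchedLaw.setIntegral_cylinder (hμ : IsQuenchedLaw Q p μ)
    {π : Fin m → ℝ} (hπ : ∀ β, 0 ≤ π β) (hQ : ∀ α β, Q α β = π β) (hπ1 : ∑ β, π β = 1)
    (hp : ∀ α k, p α k ∈ Set.Ioo (0 : ℝ) 1) {s : ℤ → ℝ}
    (hs : ∀ x, (∑ β, π β * p β x) * s (x + 1) + (1 - ∑ β, π β * p β x) * s (x - 1) = s x)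
    (α : Fin m) (i : ℤ) (n : ℕ) (traj : ℕ → Fin m × ℤ) :
    ∫ ω in cylinderUpTo n traj, s (ω (n + 1)).2 ∂μ α i =
      ∫ ω in cylinderUpTo n traj, s (ω n).2 ∂μ α i := by
  classical
  have := (hμ α i).1
  have hQ0 : ∀ α β, 0 ≤ Q α β := fun a b => by rw [hQ]; exact hπ b
  have hC := measurableSet_cylinderUpTo n traj
  set C := cylinderUpTo n traj with hCdef
  set x := (traj n).2 with hx
  set F : Finset (Fin m × ℤ) := Finset.univ ×ˢ {x + 1, x - 1} with hF
  have hmeas : ∀ y, MeasurableSet (C ∩ {ω : ℕ → Fin m × ℤ | ω (n + 1) = y}) := fun y =>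
    hC.inter (measurableSet_coord_eq (n + 1) y)
  have hunion : C =ᵐ[μ α i] ⋃ y ∈ F, C ∩ {ω : ℕ → Fin m × ℤ | ω (n + 1) = y} := by
    filter_upwards [hμ.ae_cylinder_step hQ0 hp α i n traj] with ω hω
    refine propext ⟨fun h => ?_, fun h => ?_⟩
    · refine Set.mem_iUnion₂.2 ⟨ω (n + 1), ?_, h, rfl⟩
      rw [hF, Finset.mem_product]
      simpa using hω h
    · obtain ⟨y, -, h1, -⟩ := Set.mem_iUnion₂.1 h
      exact h1
  have hleft : ∀ y, ∫ ω in C ∩ {ω : ℕ → Fin m × ℤ | ω (n + 1) = y}, s (ω (n + 1)).2 ∂μ α i =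
      (μ α i).real C * (step Q p (traj n) y * s y.2) := by
    intro y
    rw [setIntegral_congr_fun (g := fun _ => s y.2) (hmeas y) fun ω hω => by
      simp only [show ω (n + 1) = y from hω.2], setIntegral_const, measureReal_def, hCdef,
      hμ.measure_cylinder_inter hQ0 hp, ENNReal.toReal_mul,
      ENNReal.toReal_ofReal (step_nonneg hQ0 hp _ _), smul_eq_mul, measureReal_def, mul_assoc]
  have hint : ∀ y ∈ F, IntegrableOn (fun ω : ℕ → Fin m × ℤ => s (ω (n + 1)).2)
      (C ∩ {ω | ω (n + 1) = y}) (μ α i) := by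
    intro y _
    refine (integrableOn_congr_fun (g := fun _ => s y.2) (fun ω hω => ?_) (hmeas y)).2
      (integrable_const _)
    simp only [show ω (n + 1) = y from hω.2]
  have hdisj : Set.Pairwise (F : Set (Fin m × ℤ))
      (Function.onFun Disjoint fun y => C ∩ {ω : ℕ → Fin m × ℤ | ω (n + 1) = y}) := by
    intro y _ z _ hyz
    refine Set.disjoint_left.2 fun ω h1 h2 => hyz ?_
    exact (show ω (n + 1) = y from h1.2).symm.trans h2.2
  have hright : ∫ ω in C, s (ω n).2 ∂μ α i = (μ α i).real C * s x := by
    rw [setIntegral_congr_fun (g := fun _ => s x) hC fun ω hω => by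
      simp only [show ω n = traj n from hω n le_rfl, hx], setIntegral_const, smul_eq_mul]
  rw [setIntegral_congr_set hunion, integral_biUnion_finset F (fun y _ => hmeas y) hdisj hint,
    hright, Finset.sum_congr rfl fun y _ => hleft y, ← Finset.mul_sum]
  congr 1
  rw [hF, Finset.sum_product, ← hs x]
  have hterm : ∀ β : Fin m, ∑ y ∈ ({x + 1, x - 1} : Finset ℤ),
      step Q p (traj n) (β, y) * s (β, y).2 =
      π β * p β x * s (x + 1) + (π β - π β * p β x) * s (x - 1) := by
    intro β
    rw [Finset.sum_pair (by omega)]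
    simp only [step, hQ, ← hx, if_true, show x - 1 ≠ x + 1 by omega, if_false]
    ring
  rw [Finset.sum_congr rfl fun β _ => hterm β, Finset.sum_add_distrib, ← Finset.sum_mul,
    ← Finset.sum_mul, Finset.sum_sub_distrib, hπ1]

end Quenched

section Stopped

variable {ι : Type*}

open Classical in
/-- The process `s (X_n)` stopped when `X` leaves `D`. -/
noncomputable def stoppedScale (s : ℤ → ℝ) (D : Set ℤ) (ω : ℕ → ι × ℤ) : ℕ → ℝ
  | 0 => s (ω 0).2
  | n + 1 => if ∀ k ≤ n, (ω k).2 ∈ D then s (ω (n + 1)).2 else stoppedScale s D ω n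

lemma stoppedScale_eq {s : ℤ → ℝ} {D : Set ℤ} {ω : ℕ → ι × ℤ} {n : ℕ}
    (h : ∀ k < n, (ω k).2 ∈ D) : stoppedScale s D ω n = s (ω n).2 := by
  cases n with
  | zero => rfl
  | succ n => rw [stoppedScale, if_pos fun k hk => h k (Nat.lt_succ_of_le hk)]

lemma exists_stoppedScale_eq (s : ℤ → ℝ) (D : Set ℤ) (ω : ℕ → ι × ℤ) (n : ℕ) :
    ∃ j ≤ n, (∀ k < j, (ω k).2 ∈ D) ∧ stoppedScale s D ω n = s (ω j).2 := by
  induction n with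
  | zero => exact ⟨0, le_rfl, by simp, rfl⟩
  | succ n ih =>
    rw [stoppedScale]
    split_ifs with h
    · exact ⟨n + 1, le_rfl, fun k hk => h k (Nat.lt_succ_iff.1 hk), rfl⟩
    · obtain ⟨j, hj, h1, h2⟩ := ih
      exact ⟨j, hj.trans n.le_succ, h1, h2⟩

lemma abs_sub_le_of_nearest_neighbour {x : ℕ → ℤ}
    (hx : ∀ n, x (n + 1) = x n + 1 ∨ x (n + 1) = x n - 1) (n : ℕ) : |x n - x 0| ≤ n := by
  induction n with
  | zero => simp
  | succ n ih =>
    rw [abs_le] at ih ⊢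
    push_cast
    rcases hx n with h | h <;> rw [h] <;> constructor <;> linarith [ih.1, ih.2]

lemma stoppedScale_nonneg {s : ℤ → ℝ} {D : Set ℤ} {ω : ℕ → ι × ℤ}
    (hω : ∀ n, (ω (n + 1)).2 = (ω n).2 + 1 ∨ (ω (n + 1)).2 = (ω n).2 - 1)
    (h0 : 0 ≤ s (ω 0).2) (hD : ∀ x ∈ D, 0 ≤ s (x + 1) ∧ 0 ≤ s (x - 1)) (n : ℕ) :
    0 ≤ stoppedScale s D ω n := by
  obtain ⟨j, -, hj, h⟩ := exists_stoppedScale_eq s D ω n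
  rw [h]
  cases j with
  | zero => exact h0
  | succ j =>
    have := hD _ (hj j j.lt_succ_self)
    rcases hω j with h | h <;> rw [h]
    exacts [this.1, this.2]

lemma abs_stoppedScale_le {s : ℤ → ℝ} {D : Set ℤ} {ω : ℕ → ι × ℤ}
    (hω : ∀ n, (ω (n + 1)).2 = (ω n).2 + 1 ∨ (ω (n + 1)).2 = (ω n).2 - 1) (n : ℕ) :
    |stoppedScale s D ω n| ≤ ∑ x ∈ Finset.Icc ((ω 0).2 - n) ((ω 0).2 + n), |s x| := by
  obtain ⟨j, hjn, -, h⟩ := exists_stoppedScale_eq s D ω n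
  rw [h]
  refine Finset.single_le_sum (f := fun x => |s x|) (fun _ _ => abs_nonneg _) ?_
  have := abs_le.1 (abs_sub_le_of_nearest_neighbour (x := fun n => (ω n).2) hω j)
  rw [Finset.mem_Icc]
  constructor <;> linarith [this.1, this.2, (Nat.cast_le (α := ℤ)).2 hjn]

variable [MeasurableSpace ι]

lemma measurable_coord_piLE {S : Type*} [MeasurableSpace S] {k n : ℕ} (hk : k ≤ n) :
    Measurable[Filtration.piLE (X := fun _ : ℕ => S) n] fun ω : ℕ → S => ω k :=
  (measurable_pi_apply (X := fun _ : Set.Iic n => S) ⟨k, hk⟩).comp (comap_measurable _)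

lemma measurable_stoppedScale (s : ℤ → ℝ) (D : Set ℤ) (n : ℕ) :
    Measurable[Filtration.piLE (X := fun _ : ℕ => ι × ℤ) n]
      fun ω : ℕ → ι × ℤ => stoppedScale s D ω n := by
  classical
  have hs : ∀ {k n : ℕ}, k ≤ n → Measurable[Filtration.piLE (X := fun _ : ℕ => ι × ℤ) n]
      fun ω : ℕ → ι × ℤ => s (ω k).2 := fun hk =>
    ((measurable_of_countable s).comp measurable_snd).comp (measurable_coord_piLE hk)
  induction n with
  | zero => exact hs le_rfl
  | succ n ih =>
    simp only [stoppedScale]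
    refine Measurable.ite ?_ (hs le_rfl) (ih.mono (Filtration.mono _ n.le_succ) le_rfl)
    have : {ω : ℕ → ι × ℤ | ∀ k ≤ n, (ω k).2 ∈ D} =
        ⋂ k ∈ Finset.range (n + 1), (fun ω : ℕ → ι × ℤ => (ω k).2) ⁻¹' D := by
      ext ω
      simp
    rw [this]
    refine Finset.measurableSet_biInter _ fun k hk => ?_
    refine (measurable_snd.comp (measurable_coord_piLE ?_))
      (DiscreteMeasurableSpace.forall_measurableSet D)
    have := Finset.mem_range.1 hk
    omega

end Stopped

/-- Two integrable functions whose integrals agree on all cylinders up to time `n` have the same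
integral over every event depending on the path up to time `n`. -/
lemma setIntegral_eq_of_cylinderUpTo {S : Type*} [Countable S] [Nonempty S] [MeasurableSpace S]
    [MeasurableSingletonClass S] {ν : Measure (ℕ → S)} {f g : (ℕ → S) → ℝ} {n : ℕ}
    (hf : Integrable f ν) (hg : Integrable g ν)
    (h : ∀ traj, ∫ ω in cylinderUpTo n traj, f ω ∂ν = ∫ ω in cylinderUpTo n traj, g ω ∂ν)
    {B : Set (ℕ → S)} (hB : MeasurableSet[Filtration.piLE (X := fun _ : ℕ => S) n] B) :
    ∫ ω in B, f ω ∂ν = ∫ ω in B, g ω ∂ν := by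
  classical
  obtain ⟨B', -, rfl⟩ := hB
  obtain ⟨t, ht⟩ := exists_countable_cylinderUpTo_cover (S := S) n
  have hu : Preorder.restrictLe (π := fun _ : ℕ => S) n ⁻¹' B' =
      ⋃ w : B', cylinderUpTo n (t w) := by
    ext ω
    simp only [Set.mem_preimage, Set.mem_iUnion, ht]
    exact ⟨fun h => ⟨⟨_, h⟩, rfl⟩, fun ⟨w, hw⟩ => hw ▸ w.2⟩
  have hd : Pairwise (Function.onFun Disjoint fun w : B' => cylinderUpTo n (t w)) := by
    intro w w' hww
    refine Set.disjoint_left.2 fun ω h1 h2 => hww (Subtype.ext ?_)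
    exact ((ht ω w).1 h1).symm.trans ((ht ω w').1 h2)
  rw [hu, integral_iUnion (fun w => measurableSet_cylinderUpTo _ _) hd hf.integrableOn,
    integral_iUnion (fun w => measurableSet_cylinderUpTo _ _) hd hg.integrableOn]
  exact tsum_congr fun w => h _

section QuenchedLimit

variable {m : ℕ} {Q : Matrix (Fin m) (Fin m) ℝ} {p : Fin m → ℤ → ℝ}
  {μ : Fin m → ℤ → Measure (ℕ → Fin m × ℤ)}

lemma IsQuenchedLaw.integrable_stoppedScale (hμ : IsQuenchedLaw Q p μ)
    (hQ : ∀ α β, 0 ≤ Q α β) (hp : ∀ α k, p α k ∈ Set.Ioo (0 : ℝ) 1)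
    (s : ℤ → ℝ) (D : Set ℤ) (α : Fin m) (i : ℤ) (n : ℕ) :
    Integrable (fun ω => stoppedScale s D ω n) (μ α i) := by
  have := (hμ α i).1
  refine Integrable.of_bound (C := ∑ x ∈ Finset.Icc (i - n) (i + n), |s x|)
    ((measurable_stoppedScale s D n).mono (Filtration.le _ n) le_rfl).aestronglyMeasurable ?_
  filter_upwards [hμ.ae_start α i, hμ.ae_nearest_neighbour hQ hp α i] with ω h0 h1
  have := abs_stoppedScale_le (s := s) (D := D) h1 n
  rwa [h0] at this

lemma IsQuenchedLaw.martingale_stoppedScale (hμ : IsQuenchedLaw Q p μ)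
    {π : Fin m → ℝ} (hπ : ∀ β, 0 ≤ π β) (hQ : ∀ α β, Q α β = π β) (hπ1 : ∑ β, π β = 1)
    (hp : ∀ α k, p α k ∈ Set.Ioo (0 : ℝ) 1) {s : ℤ → ℝ}
    (hs : ∀ x, (∑ β, π β * p β x) * s (x + 1) + (1 - ∑ β, π β * p β x) * s (x - 1) = s x)
    (D : Set ℤ) (α : Fin m) (i : ℤ) :
    Martingale (fun n ω => stoppedScale s D ω n)
      (Filtration.piLE (X := fun _ : ℕ => Fin m × ℤ)) (μ α i) := by
  classical
  have := (hμ α i).1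
  have : Nonempty (Fin m × ℤ) := ⟨(α, i)⟩
  have hint := hμ.integrable_stoppedScale (fun a b => by rw [hQ]; exact hπ b) hp s D α i
  refine martingale_of_setIntegral_eq_succ
    (fun n => (measurable_stoppedScale s D n).stronglyMeasurable) hint fun n B hB => ?_
  refine setIntegral_eq_of_cylinderUpTo (hint n) (hint (n + 1)) (fun traj => ?_) hB
  have hC := measurableSet_cylinderUpTo n traj
  by_cases hD : ∀ k ≤ n, (traj k).2 ∈ D
  · rw [setIntegral_congr_fun (g := fun ω => s (ω n).2) hC fun ω hω =>
        stoppedScale_eq fun k hk => by rw [hω k hk.le]; exact hD k hk.le,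
      setIntegral_congr_fun (f := fun ω => stoppedScale s D ω (n + 1))
        (g := fun ω => s (ω (n + 1)).2) hC fun ω hω =>
        stoppedScale_eq fun k hk => by
          rw [hω k (Nat.lt_succ_iff.1 hk)]; exact hD k (Nat.lt_succ_iff.1 hk)]
    exact (hμ.setIntegral_cylinder hπ hQ hπ1 hp hs α i n traj).symm
  · refine setIntegral_congr_fun hC fun ω hω => ?_
    simp only [stoppedScale]
    rw [if_neg]
    exact fun h => hD fun k hk => hω k hk ▸ h k hk

/-- A nonnegative harmonic function converges along the paths that stay in `D`. -/
lemma IsQuenchedLaw.ae_tendsto_of_nonneg (hμ : IsQuenchedLaw Q p μ)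
    {π : Fin m → ℝ} (hπ : ∀ β, 0 ≤ π β) (hQ : ∀ α β, Q α β = π β) (hπ1 : ∑ β, π β = 1)
    (hp : ∀ α k, p α k ∈ Set.Ioo (0 : ℝ) 1) {s : ℤ → ℝ}
    (hs : ∀ x, (∑ β, π β * p β x) * s (x + 1) + (1 - ∑ β, π β * p β x) * s (x - 1) = s x)
    {D : Set ℤ} (hD : ∀ x ∈ D, 0 ≤ s (x + 1) ∧ 0 ≤ s (x - 1)) (α : Fin m) {i : ℤ}
    (hi : 0 ≤ s i) :
    ∀ᵐ ω ∂μ α i, (∀ n, (ω n).2 ∈ D) → ∃ L, Tendsto (fun n => s (ω n).2) atTop (𝓝 L) := by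
  have := (hμ α i).1
  have hQ0 : ∀ α β, 0 ≤ Q α β := fun a b => by rw [hQ]; exact hπ b
  have hM := hμ.martingale_stoppedScale hπ hQ hπ1 hp hs D α i
  have hbdd : ∀ n, eLpNorm (fun ω => stoppedScale s D ω n) 1 (μ α i) ≤
      ((∫ ω, stoppedScale s D ω 0 ∂μ α i).toNNReal : ℝ≥0∞) := by
    intro n
    have heq : ∫ ω, stoppedScale s D ω 0 ∂μ α i = ∫ ω, stoppedScale s D ω n ∂μ α i := by
      have := hM.setIntegral_eq (Nat.zero_le n) MeasurableSet.univ
      simpa only [setIntegral_univ] using this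
    have hnn : 0 ≤ᵐ[μ α i] fun ω => stoppedScale s D ω n := by
      filter_upwards [hμ.ae_start α i, hμ.ae_nearest_neighbour hQ0 hp α i] with ω h0 h1
      exact stoppedScale_nonneg h1 (by rw [h0]; exact hi) hD n
    rw [eLpNorm_one_eq_lintegral_enorm, heq]
    change _ ≤ ENNReal.ofReal _
    rw [ofReal_integral_eq_lintegral_ofReal (hM.integrable n) hnn]
    refine le_of_eq (lintegral_congr_ae ?_)
    filter_upwards [hnn] with ω hω
    exact Real.enorm_eq_ofReal hω
  filter_upwards [hM.submartingale.exists_ae_tendsto_of_bdd hbdd] with ω hω hωD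
  obtain ⟨L, hL⟩ := hω
  exact ⟨L, hL.congr fun n => stoppedScale_eq fun k _ => hωD k⟩

/-- A harmonic function bounded above near `D` converges along the paths that stay in `D`. -/
lemma IsQuenchedLaw.ae_tendsto_of_le (hμ : IsQuenchedLaw Q p μ)
    {π : Fin m → ℝ} (hπ : ∀ β, 0 ≤ π β) (hQ : ∀ α β, Q α β = π β) (hπ1 : ∑ β, π β = 1)
    (hp : ∀ α k, p α k ∈ Set.Ioo (0 : ℝ) 1) {s : ℤ → ℝ}
    (hs : ∀ x, (∑ β, π β * p β x) * s (x + 1) + (1 - ∑ β, π β * p β x) * s (x - 1) = s x)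
    {D : Set ℤ} {c : ℝ} (hD : ∀ x ∈ D, s (x + 1) ≤ c ∧ s (x - 1) ≤ c) (α : Fin m) (i : ℤ) :
    ∀ᵐ ω ∂μ α i, (∀ n, (ω n).2 ∈ D) → ∃ L, Tendsto (fun n => s (ω n).2) atTop (𝓝 L) := by
  have h := hμ.ae_tendsto_of_nonneg hπ hQ hπ1 hp (s := fun x => max c (s i) - s x)
    (fun x => by linear_combination -(hs x)) (D := D)
    (fun x hx => ⟨sub_nonneg.2 (le_max_of_le_left (hD x hx).1),
      sub_nonneg.2 (le_max_of_le_left (hD x hx).2)⟩) α (sub_nonneg.2 (le_max_right c (s i)))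
  filter_upwards [h] with ω hω hωD
  obtain ⟨L, hL⟩ := hω hωD
  exact ⟨max c (s i) - L, by simpa using hL.const_sub (max c (s i))⟩

/-- A harmonic function bounded below near `D` converges along the paths that stay in `D`. -/
lemma IsQuenchedLaw.ae_tendsto_of_ge (hμ : IsQuenchedLaw Q p μ)
    {π : Fin m → ℝ} (hπ : ∀ β, 0 ≤ π β) (hQ : ∀ α β, Q α β = π β) (hπ1 : ∑ β, π β = 1)
    (hp : ∀ α k, p α k ∈ Set.Ioo (0 : ℝ) 1) {s : ℤ → ℝ}
    (hs : ∀ x, (∑ β, π β * p β x) * s (x + 1) + (1 - ∑ β, π β * p β x) * s (x - 1) = s x)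
    {D : Set ℤ} {c : ℝ} (hD : ∀ x ∈ D, c ≤ s (x + 1) ∧ c ≤ s (x - 1)) (α : Fin m) (i : ℤ) :
    ∀ᵐ ω ∂μ α i, (∀ n, (ω n).2 ∈ D) → ∃ L, Tendsto (fun n => s (ω n).2) atTop (𝓝 L) := by
  have h := hμ.ae_tendsto_of_le hπ hQ hπ1 hp (s := fun x => -s x) (c := -c)
    (fun x => by linear_combination -(hs x)) (D := D)
    (fun x hx => ⟨neg_le_neg (hD x hx).1, neg_le_neg (hD x hx).2⟩) α i
  filter_upwards [h] with ω hω hωD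
  obtain ⟨L, hL⟩ := hω hωD
  exact ⟨-L, by simpa using hL.neg⟩

end QuenchedLimit

lemma frequently_lt_of_unbounded {x : ℕ → ℤ}
    (hx : ∀ n, x (n + 1) = x n + 1 ∨ x (n + 1) = x n - 1) (h : ∀ K, ∃ n, K ≤ x n) (M : ℤ) :
    ∃ᶠ n in atTop, M < x n := by
  refine frequently_atTop.2 fun N => ?_
  obtain ⟨n, hn⟩ := h (max (M + 1) (x 0 + N + 1))
  have h1 := (abs_le.1 (abs_sub_le_of_nearest_neighbour hx n)).2
  have h2 := (le_max_left _ _).trans hn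
  have h3 := (le_max_right _ _).trans hn
  exact ⟨n, by omega, by omega⟩

lemma frequently_gt_of_unbounded {x : ℕ → ℤ}
    (hx : ∀ n, x (n + 1) = x n + 1 ∨ x (n + 1) = x n - 1) (h : ∀ K, ∃ n, x n ≤ K) (M : ℤ) :
    ∃ᶠ n in atTop, x n < M := by
  have := frequently_lt_of_unbounded (x := fun n => -x n)
    (fun n => by rcases hx n with h | h <;> omega)
    (fun K => (h (-K)).imp fun n hn => by omega) (-M)
  exact this.mono fun n hn => by omega

lemma measure_eq_one_of_ae {Ω : Type*} [MeasurableSpace Ω] {ν : Measure Ω}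
    [IsProbabilityMeasure ν] {A : Set Ω} (h : ∀ᵐ ω ∂ν, ω ∈ A) : ν A = 1 := by
  have hA : A =ᵐ[ν] Set.univ := eventuallyEq_univ.2 h
  rw [measure_congr hA, measure_univ]

section QuenchedConclusion

variable {m : ℕ} {Q : Matrix (Fin m) (Fin m) ℝ} {p : Fin m → ℤ → ℝ}
  {μ : Fin m → ℤ → Measure (ℕ → Fin m × ℤ)}

lemma IsQuenchedLaw.driftTop_eq_one (hμ : IsQuenchedLaw Q p μ)
    {π : Fin m → ℝ} (hπ : ∀ β, 0 ≤ π β) (hQ : ∀ α β, Q α β = π β) (hπ1 : ∑ β, π β = 1)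
    (hp : ∀ α k, p α k ∈ Set.Ioo (0 : ℝ) 1) {s : ℤ → ℝ} (hmono : StrictMono s)
    (hs : ∀ x, (∑ β, π β * p β x) * s (x + 1) + (1 - ∑ β, π β * p β x) * s (x - 1) = s x)
    {c : ℝ} (hc : ∀ x, s x ≤ c) (hbot : Tendsto s atBot atBot) (α : Fin m) (i : ℤ) :
    μ α i driftTop = 1 := by
  have := (hμ α i).1
  refine measure_eq_one_of_ae ?_
  filter_upwards [hμ.ae_tendsto_of_le hπ hQ hπ1 hp hs (D := Set.univ)
    (fun x _ => ⟨hc _, hc _⟩) α i,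
    hμ.ae_nearest_neighbour (fun a b => by rw [hQ]; exact hπ b) hp α i] with ω h1 h2
  obtain ⟨L, hL⟩ := h1 fun _ => Set.mem_univ _
  exact tendsto_atTop_of_scale_tendsto (x := fun n => (ω n).2) hmono hbot h2 hL

lemma IsQuenchedLaw.driftBot_eq_one (hμ : IsQuenchedLaw Q p μ)
    {π : Fin m → ℝ} (hπ : ∀ β, 0 ≤ π β) (hQ : ∀ α β, Q α β = π β) (hπ1 : ∑ β, π β = 1)
    (hp : ∀ α k, p α k ∈ Set.Ioo (0 : ℝ) 1) {s : ℤ → ℝ} (hmono : StrictMono s)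
    (hs : ∀ x, (∑ β, π β * p β x) * s (x + 1) + (1 - ∑ β, π β * p β x) * s (x - 1) = s x)
    {c : ℝ} (hc : ∀ x, c ≤ s x) (htop : Tendsto s atTop atTop) (α : Fin m) (i : ℤ) :
    μ α i driftBot = 1 := by
  have := (hμ α i).1
  refine measure_eq_one_of_ae ?_
  filter_upwards [hμ.ae_tendsto_of_ge hπ hQ hπ1 hp hs (D := Set.univ)
    (fun x _ => ⟨hc _, hc _⟩) α i,
    hμ.ae_nearest_neighbour (fun a b => by rw [hQ]; exact hπ b) hp α i] with ω h1 h2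
  obtain ⟨L, hL⟩ := h1 fun _ => Set.mem_univ _
  exact tendsto_atBot_of_scale_tendsto (x := fun n => (ω n).2) hmono htop h2 hL

lemma IsQuenchedLaw.oscillate_eq_one (hμ : IsQuenchedLaw Q p μ)
    {π : Fin m → ℝ} (hπ : ∀ β, 0 ≤ π β) (hQ : ∀ α β, Q α β = π β) (hπ1 : ∑ β, π β = 1)
    (hp : ∀ α k, p α k ∈ Set.Ioo (0 : ℝ) 1) {s : ℤ → ℝ} (hmono : StrictMono s)
    (hs : ∀ x, (∑ β, π β * p β x) * s (x + 1) + (1 - ∑ β, π β * p β x) * s (x - 1) = s x)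
    (hbot : Tendsto s atBot atBot) (htop : Tendsto s atTop atTop) (α : Fin m) (i : ℤ) :
    μ α i oscillate = 1 := by
  have := (hμ α i).1
  refine measure_eq_one_of_ae ?_
  have hlt := fun K : ℤ => hμ.ae_tendsto_of_le hπ hQ hπ1 hp hs (D := Set.Iio K) (c := s K)
    (fun x hx => by
      rw [Set.mem_Iio] at hx
      exact ⟨hmono.monotone (by omega), hmono.monotone (by omega)⟩) α i
  have hgt := fun K : ℤ => hμ.ae_tendsto_of_ge hπ hQ hπ1 hp hs (D := Set.Ioi K) (c := s K)
    (fun x hx => by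
      rw [Set.mem_Ioi] at hx
      exact ⟨hmono.monotone (by omega), hmono.monotone (by omega)⟩) α i
  filter_upwards [ae_all_iff.2 hlt, ae_all_iff.2 hgt,
    hμ.ae_nearest_neighbour (fun a b => by rw [hQ]; exact hπ b) hp α i] with ω h1 h2 hnn
  constructor
  · refine frequently_gt_of_unbounded (x := fun n => (ω n).2) hnn fun K => ?_
    by_contra! hK
    obtain ⟨L, hL⟩ := h2 K hK
    have := tendsto_atBot_of_scale_tendsto (x := fun n => (ω n).2) hmono htop hnn hL
    obtain ⟨n, hn⟩ := (this.eventually_le_atBot K).exists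
    exact (hK n).not_ge hn
  · refine frequently_lt_of_unbounded (x := fun n => (ω n).2) hnn fun K => ?_
    by_contra! hK
    obtain ⟨L, hL⟩ := h1 K hK
    have := tendsto_atTop_of_scale_tendsto (x := fun n => (ω n).2) hmono hbot hnn hL
    obtain ⟨n, hn⟩ := (this.eventually_ge_atTop K).exists
    exact (hK n).not_ge hn

end QuenchedConclusion

lemma not_tendsto_neg_atBot_of_le_linear {x : ℕ → ℝ}
    (h : ∃ ε > 0, ∃ C, ∀ n : ℕ, x n ≤ C - ε * n) :
    ¬ Tendsto (fun n => -x n) atTop atBot := by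
  obtain ⟨ε, hε, C, hC⟩ := h
  intro ht
  obtain ⟨n, hn⟩ := (ht.eventually_le_atBot (-C - 1)).exists
  have := hC n
  have : 0 ≤ ε * n := by positivity
  linarith

lemma sum_mul_mem_Ioo {m : ℕ} {π q : Fin m → ℝ} (hπ : ∀ β, 0 < π β) (hπ1 : ∑ β, π β = 1)
    (hq : ∀ β, q β ∈ Set.Ioo (0 : ℝ) 1) : ∑ β, π β * q β ∈ Set.Ioo (0 : ℝ) 1 := by
  have hne : (Finset.univ : Finset (Fin m)).Nonempty := by
    by_contra h
    rw [Finset.not_nonempty_iff_eq_empty] at h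
    simp [h] at hπ1
  refine ⟨Finset.sum_pos (fun β _ => mul_pos (hπ β) (hq β).1) hne, ?_⟩
  rw [← hπ1]
  exact Finset.sum_lt_sum_of_nonempty hne fun β _ => mul_lt_of_lt_one_right (hπ β) (hq β).2

lemma lt_of_coe_sub_pos {a b : ℝ≥0∞} (h : (0 : EReal) < (a : EReal) - (b : EReal)) : b < a :=
  EReal.coe_ennreal_lt_coe_ennreal_iff.1 (EReal.sub_pos.1 h)

lemma lt_of_coe_sub_neg {a b : ℝ≥0∞} (hab : a ≠ ⊤ ∨ b ≠ ⊤)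
    (h : (a : EReal) - (b : EReal) < 0) : a < b :=
  EReal.coe_ennreal_lt_coe_ennreal_iff.1 ((EReal.sub_neg (by simpa using hab) (by simp)).1 h)

lemma eq_of_coe_sub_eq_zero {a b : ℝ≥0∞} (hab : a ≠ ⊤ ∨ b ≠ ⊤)
    (h : (a : EReal) - (b : EReal) = 0) : a = b :=
  EReal.coe_ennreal_injective (le_antisymm (EReal.sub_nonpos.1 h.le)
    ((EReal.sub_nonneg (by simpa using hab) (by simp)).1 h.ge))

/-! ### Statement 8: Corollary `cor:ind` (rank-1 case) -/

theorem stmt8_cor_ind {m : ℕ} (hm : 0 < m)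
    {E : Type*} [MeasurableSpace E] (P : Measure E) [IsProbabilityMeasure P]
    (hPc : P.IsComplete) (T : E → E) (hT : Ergodic T P)
    (π : Fin m → ℝ) (hπpos : ∀ β, 0 < π β) (hπsum : ∑ β, π β = 1)
    (Q : Matrix (Fin m) (Fin m) ℝ) (hQ : ∀ α β, Q α β = π β)
    (p : Fin m → ℤ → E → ℝ) (hpmeas : ∀ α k, Measurable (p α k))
    (hp01 : ∀ α k e, p α k e ∈ Set.Ioo (0 : ℝ) 1)
    (hpT : ∀ α k e, p α k (T e) = p α (k + 1) e)
    (μ : E → Fin m → ℤ → Measure (ℕ → Fin m × ℤ))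
    (hμ : ∀ e, IsQuenchedLaw Q (fun α k => p α k e) (μ e))
    (pb : ℤ → E → ℝ) (hpb : ∀ i e, pb i e = ∑ β, π β * p β i e)
    (σ : E → ℝ) (hσ : ∀ e, σ e = (1 - pb 0 e) / pb 0 e)
    (u : EReal)
    (hwd : (∫⁻ e, ENNReal.ofReal (Real.log (σ e)) ∂P) ≠ ⊤ ∨
           (∫⁻ e, ENNReal.ofReal (-Real.log (σ e)) ∂P) ≠ ⊤)
    (hu : u = ((∫⁻ e, ENNReal.ofReal (Real.log (σ e)) ∂P : ℝ≥0∞) : EReal)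
            - ((∫⁻ e, ENNReal.ofReal (-Real.log (σ e)) ∂P : ℝ≥0∞) : EReal)) :
    (0 < u → ∀ (α : Fin m) (i : ℤ), ∀ᵐ e ∂P, μ e α i driftBot = 1) ∧
    (u < 0 → ∀ (α : Fin m) (i : ℤ), ∀ᵐ e ∂P, μ e α i driftTop = 1) ∧
    (u = 0 → ∀ (α : Fin m) (i : ℤ), ∀ᵐ e ∂P, μ e α i oscillate = 1) := by
  have hpb01 : ∀ k e, pb k e ∈ Set.Ioo (0 : ℝ) 1 := fun k e => by
    rw [hpb]
    exact sum_mul_mem_Ioo hπpos hπsum fun β => hp01 β k e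
  have hpbm : ∀ k, Measurable (pb k) := fun k => by
    rw [show pb k = fun e => ∑ β, π β * p β k e from funext (hpb k)]
    exact Finset.measurable_sum _ fun β _ => (hpmeas β k).const_mul _
  have hpbT : ∀ k e, pb k (T e) = pb (k + 1) e := fun k e => by
    rw [hpb, hpb]
    exact Finset.sum_congr rfl fun β _ => by rw [hpT]
  have hπ0 : ∀ β, 0 ≤ π β := fun β => (hπpos β).le
  set f : ℤ → E → ℝ := fun k e => Real.log ((1 - pb k e) / pb k e) with hf
  have hfm : ∀ k, Measurable (f k) := fun k =>
    Real.measurable_log.comp ((measurable_const.sub (hpbm k)).div (hpbm k))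
  have hfT : ∀ k e, f k (T e) = f (k + 1) e := fun k e => by simp only [hf, hpbT]
  have hgm : ∀ k, Measurable fun e => -f k e := fun k => (hfm k).neg
  have hgT : ∀ k e, -f k (T e) = -f (k + 1) e := fun k e => by rw [hfT]
  have hσf : ∀ e, Real.log (σ e) = f 0 e := fun e => by rw [hσ]
  simp only [hσf] at hwd hu
  have hscale := fun e => exists_scale_function (fun x => pb x e) (fun x => hpb01 x e)
    (fun x => f x e) fun x => rfl
  refine ⟨fun hpos α i => ?_, fun hneg α i => ?_, fun hzero α i => ?_⟩
  · have hlt := lt_of_coe_sub_pos (hu ▸ hpos)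
    filter_upwards [ae_sum_le_linear (f := fun k e => -f k e) hT hgm hgT
      (by simpa only [neg_neg] using hlt)] with e he
    obtain ⟨s, hmono, hs, -, htop, hbdd, -⟩ := hscale e
    simp only [hpb] at hs
    obtain ⟨c, hc⟩ := hbdd he.2
    refine (hμ e).driftBot_eq_one hπ0 hQ hπsum (fun α k => hp01 α k e) hmono hs hc (htop ?_) α i
    simpa only [Finset.sum_neg_distrib, neg_neg] using not_tendsto_neg_atBot_of_le_linear he.1
  · have hlt := lt_of_coe_sub_neg hwd (hu ▸ hneg)
    filter_upwards [ae_sum_le_linear hT hfm hfT hlt] with e he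
    obtain ⟨s, hmono, hs, hbdd, -, -, hbot⟩ := hscale e
    simp only [hpb] at hs
    obtain ⟨c, hc⟩ := hbdd he.1
    refine (hμ e).driftTop_eq_one hπ0 hQ hπsum (fun α k => hp01 α k e) hmono hs hc (hbot ?_) α i
    simpa only [Finset.sum_neg_distrib] using not_tendsto_neg_atBot_of_le_linear he.2
  · have heq := eq_of_coe_sub_eq_zero hwd (hu ▸ hzero)
    have htop := hwd.elim id (heq ▸ ·)
    filter_upwards [ae_not_tendsto_sum_atBot hT hfm hfT htop heq,
      ae_not_tendsto_sum_atBot (f := fun k e => -f k e) hT hgm hgT (heq ▸ htop)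
        (by simpa only [neg_neg] using heq.symm)] with e he he'
    obtain ⟨s, hmono, hs, -, htop, -, hbot⟩ := hscale e
    simp only [hpb] at hs
    exact (hμ e).oscillate_eq_one hπ0 hQ hπsum (fun α k => hp01 α k e) hmono hs
      (hbot he'.2) (htop he.1) α i

end Parrondo
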